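/- A model M of S_α is atomic if and only if every finite substructure A ⊆ M is contained in a finite substructure B ⊆ M with δ(B) = 0. -/

import Mathlib

open Finset

/-- The number of subsets of `A` on which the relation `E` holds. -/
noncomputable def edgeCount {L V : Type} (rel : L → Finset V → Prop) (E : L)
    (A : Finset V) : ℕ :=
  {e : Finset V | e ⊆ A ∧ rel E e}.ncard

/-- The rank function `δ(A) = |A| - ∑_E α_E · N_E(A)`. -/
noncomputable def delta {L V : Type} [Fintype L] (α : L → ℝ)
    (rel : L → Finset V → Prop) (A : Finset V) : ℝ :=
  (A.card : ℝ) - ∑ E, α E * (edgeCount rel E A : ℝ)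

/-- `A` is strong in `B`: `A ⊆ B` and `δ(A) ≤ δ(A')` for all `A ⊆ A' ⊆ B`. -/
def strong {L V : Type} [Fintype L] (α : L → ℝ) (rel : L → Finset V → Prop)
    (A B : Finset V) : Prop :=
  A ⊆ B ∧ ∀ A' : Finset V, A ⊆ A' → A' ⊆ B → delta α rel A ≤ delta α rel A'

/-- Membership in `K_α`: all substructures have nonnegative rank. -/
def inK {L V : Type} [Fintype L] (α : L → ℝ) (rel : L → Finset V → Prop)
    (A : Finset V) : Prop :=
  ∀ A' ⊆ A, 0 ≤ delta α rel A'

/-- `(A, B)` is a minimal pair: `A ≤ C` for all `A ⊆ C ⊊ B` but `A ≰ B`. -/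
def minPair {L V : Type} [Fintype L] (α : L → ℝ) (rel : L → Finset V → Prop)
    (A B : Finset V) : Prop :=
  A ⊆ B ∧ (∀ C : Finset V, A ⊆ C → C ⊂ B → strong α rel A C) ∧ ¬ strong α rel A B

open FirstOrder FirstOrder.Language

/-- The language of hypergraphs for `L`: one `ar E`-ary relation symbol for each
`E ∈ L`, and no function symbols. -/
def hypLang (L : Type) (ar : L → ℕ) : Language :=
  { Functions := fun _ => Empty, Relations := fun n => {E : L // ar E = n} }

/-- The hyperedge relation induced on finite subsets by a `hypLang`-structure:
`E` holds on `e` iff some injective enumeration of `e` satisfies the symbol `E`. -/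
def relOf (L : Type) (ar : L → ℕ) (V : Type) [DecidableEq V]
    [(hypLang L ar).Structure V] : L → Finset V → Prop :=
  fun E e => ∃ x : Fin (ar E) → V, Function.Injective x ∧
    Finset.univ.image x = e ∧
    @Structure.RelMap (hypLang L ar) V _ (ar E) ⟨E, rfl⟩ x

/-- The relations are interpreted symmetrically and irreflexively. -/
def properStructure (L : Type) (ar : L → ℕ) (V : Type)
    [(hypLang L ar).Structure V] : Prop :=
  ∀ (n : ℕ) (R : (hypLang L ar).Relations n) (x : Fin n → V),
    (@Structure.RelMap (hypLang L ar) V _ n R x → Function.Injective x) ∧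
    ∀ σ : Equiv.Perm (Fin n),
      @Structure.RelMap (hypLang L ar) V _ n R x →
        @Structure.RelMap (hypLang L ar) V _ n R (x ∘ σ)

/-- `V ⊨ S_α`: `V` is a symmetric irreflexive structure, every finite
substructure lies in `K_α`, and for all `A ≤ B` in `K_α` every embedding of `A`
into `V` extends to an embedding of `B` into `V`. -/
def modelsSalpha (L : Type) [Fintype L] (ar : L → ℕ) (α : L → ℝ) (V : Type)
    [DecidableEq V] [(hypLang L ar).Structure V] : Prop :=
  properStructure L ar V ∧
  (∀ A : Finset V, inK α (relOf L ar V) A) ∧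
  ∀ rel' : L → Finset ℕ → Prop, (∀ E e, rel' E e → e.card = ar E) →
    ∀ A B : Finset ℕ, A ⊆ B → inK α rel' B → strong α rel' A B →
      ∀ f : ℕ → V, Set.InjOn f ↑A →
        (∀ E (e : Finset ℕ), e ⊆ A → (rel' E e ↔ relOf L ar V E (e.image f))) →
        ∃ g : ℕ → V, Set.InjOn g ↑B ∧ (∀ a ∈ A, g a = f a) ∧
          ∀ E (e : Finset ℕ), e ⊆ B → (rel' E e ↔ relOf L ar V E (e.image g))

/-- `V` is an atomic model: the type of every finite tuple is isolated by a
single formula, relative to the class of models of `S_α`. -/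
def atomicModel (L : Type) [Fintype L] (ar : L → ℕ) (α : L → ℝ) (V : Type)
    [DecidableEq V] [(hypLang L ar).Structure V] : Prop :=
  ∀ (n : ℕ) (a : Fin n → V), ∃ φ : (hypLang L ar).Formula (Fin n),
    φ.Realize a ∧
    ∀ ψ : (hypLang L ar).Formula (Fin n), ψ.Realize a →
      ∀ (W : Type) [DecidableEq W] [(hypLang L ar).Structure W],
        modelsSalpha L ar α W → ∀ b : Fin n → W, φ.Realize b → ψ.Realize b

section Rank

variable {L V W : Type}

theorem edgeSet_finite (rel : L → Finset V → Prop) (E : L) (A : Finset V) :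
    {e : Finset V | e ⊆ A ∧ rel E e}.Finite := by
  classical
  exact (A.powerset.finite_toSet).subset (fun e he => by simpa using he.1)

theorem edgeCount_congr {rel rel' : L → Finset V → Prop} {A : Finset V} (E : L)
    (h : ∀ e ⊆ A, (rel E e ↔ rel' E e)) : edgeCount rel E A = edgeCount rel' E A := by
  unfold edgeCount
  congr 1
  ext e
  simp only [Set.mem_ofPred_eq]
  exact and_congr_right (h e)

theorem edgeCount_image [DecidableEq W] {rel : L → Finset V → Prop}
    {rel' : L → Finset W → Prop} {f : V → W} {A : Finset V} (hf : Set.InjOn f A) (E : L)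
    (h : ∀ e ⊆ A, (rel E e ↔ rel' E (e.image f))) :
    edgeCount rel' E (A.image f) = edgeCount rel E A := by
  unfold edgeCount
  have himg : {e : Finset W | e ⊆ A.image f ∧ rel' E e}
      = (fun e : Finset V => e.image f) '' {e : Finset V | e ⊆ A ∧ rel E e} := by
    ext e
    simp only [Set.mem_ofPred_eq, Set.mem_image]
    constructor
    · rintro ⟨he, hr⟩
      obtain ⟨e', he', rfl⟩ := Finset.subset_image_iff.1 he
      have he'' : e' ⊆ A := by exact_mod_cast he'
      exact ⟨e', ⟨he'', (h e' he'').2 hr⟩, rfl⟩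
    · rintro ⟨e', ⟨he', hr⟩, rfl⟩
      exact ⟨Finset.image_subset_image he', (h e' he').1 hr⟩
  rw [himg]
  apply Set.InjOn.ncard_image
  intro a ha b hb hab
  have ha' : (a : Set V) ⊆ A := by exact_mod_cast ha.1
  have hb' : (b : Set V) ⊆ A := by exact_mod_cast hb.1
  have : f '' (a : Set V) = f '' (b : Set V) := by
    have := congrArg (fun e : Finset W => (e : Set W)) hab
    simpa using this
  exact_mod_cast (hf.image_eq_image_iff ha' hb').1 this

theorem edgeCount_supermodular [DecidableEq V] (rel : L → Finset V → Prop) (E : L)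
    (X Y : Finset V) :
    edgeCount rel E X + edgeCount rel E Y ≤ edgeCount rel E (X ∪ Y) + edgeCount rel E (X ∩ Y) := by
  unfold edgeCount
  rw [← Set.ncard_union_add_ncard_inter _ _ (edgeSet_finite rel E X) (edgeSet_finite rel E Y)]
  apply Nat.add_le_add
  · refine Set.ncard_le_ncard ?_ (edgeSet_finite rel E _)
    rintro e (he | he)
    · exact ⟨he.1.trans subset_union_left, he.2⟩
    · exact ⟨he.1.trans subset_union_right, he.2⟩
  · refine Set.ncard_le_ncard ?_ (edgeSet_finite rel E _)
    rintro e ⟨he, he'⟩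
    exact ⟨subset_inter he.1 he'.1, he.2⟩

variable [Fintype L] {α : L → ℝ}

theorem delta_congr {rel rel' : L → Finset V → Prop} {A : Finset V}
    (h : ∀ E, ∀ e ⊆ A, (rel E e ↔ rel' E e)) : delta α rel A = delta α rel' A := by
  unfold delta
  simp only [fun E => edgeCount_congr E (h E)]

theorem delta_image [DecidableEq W] {rel : L → Finset V → Prop}
    {rel' : L → Finset W → Prop} {f : V → W} {A : Finset V} (hf : Set.InjOn f A)
    (h : ∀ E, ∀ e ⊆ A, (rel E e ↔ rel' E (e.image f))) :
    delta α rel' (A.image f) = delta α rel A := by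
  unfold delta
  simp only [fun E => edgeCount_image hf E (h E), Finset.card_image_of_injOn hf]

theorem delta_submodular [DecidableEq V] (hα : ∀ E, 0 ≤ α E) (rel : L → Finset V → Prop)
    (X Y : Finset V) :
    delta α rel (X ∪ Y) + delta α rel (X ∩ Y) ≤ delta α rel X + delta α rel Y := by
  unfold delta
  have hc : ((X ∪ Y).card : ℝ) + ((X ∩ Y).card : ℝ) = X.card + Y.card := by
    exact_mod_cast Finset.card_union_add_card_inter X Y
  have hs : ∑ E, α E * (edgeCount rel E X : ℝ) + ∑ E, α E * (edgeCount rel E Y : ℝ)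
      ≤ ∑ E, α E * (edgeCount rel E (X ∪ Y) : ℝ) + ∑ E, α E * (edgeCount rel E (X ∩ Y) : ℝ) := by
    rw [← Finset.sum_add_distrib, ← Finset.sum_add_distrib]
    apply Finset.sum_le_sum
    intro E _
    rw [← mul_add, ← mul_add]
    apply mul_le_mul_of_nonneg_left _ (hα E)
    exact_mod_cast edgeCount_supermodular rel E X Y
  linarith

theorem delta_le_card (hα : ∀ E, 0 ≤ α E) (rel : L → Finset V → Prop) (X : Finset V) :
    delta α rel X ≤ X.card := by
  unfold delta
  have : 0 ≤ ∑ E, α E * (edgeCount rel E X : ℝ) :=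
    Finset.sum_nonneg fun E _ => mul_nonneg (hα E) (Nat.cast_nonneg _)
  linarith

/-- The subgroup of `ℝ` in which all ranks lie. -/
def rankGroup (α : L → ℝ) : AddSubgroup ℝ := AddSubgroup.closure (insert 1 (Set.range α))

theorem delta_mem_rankGroup (rel : L → Finset V → Prop) (X : Finset V) :
    delta α rel X ∈ rankGroup α := by
  unfold delta
  have h1 : (1 : ℝ) ∈ rankGroup α := AddSubgroup.subset_closure (Set.mem_insert _ _)
  refine sub_mem ?_ (sum_mem fun E _ => ?_)
  · have := nsmul_mem h1 X.card
    simpa using this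
  · have h2 : α E ∈ rankGroup α :=
      AddSubgroup.subset_closure (Set.mem_insert_of_mem _ ⟨E, rfl⟩)
    have := nsmul_mem h2 (edgeCount rel E X)
    simpa [mul_comm] using this

/-- All edges are contained in `D` and have the right arity. -/
def supportedOn (ar : L → ℕ) (rel : L → Finset V → Prop) (D : Finset V) : Prop :=
  ∀ E e, rel E e → e ⊆ D ∧ e.card = ar E

theorem delta_empty {ar : L → ℕ} (har : ∀ E, 2 ≤ ar E) {rel : L → Finset V → Prop}
    (hr : ∀ E e, rel E e → e.card = ar E) : delta α rel ∅ = 0 := by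
  have : ∀ E, edgeCount rel E ∅ = 0 := by
    intro E
    unfold edgeCount
    rw [Set.ncard_eq_zero (edgeSet_finite rel E ∅)]
    ext e
    simp only [Finset.subset_empty, Set.mem_ofPred_eq, Set.mem_empty_iff_false, iff_false, not_and]
    rintro rfl h
    have h1 := hr E _ h
    have h2 := har E
    simp at h1
    omega
  simp [delta, this]

/-- The hypergraph obtained by adding the `E`-edges in `F`. -/
def addEdges (rel : L → Finset V → Prop) (E : L) (F : Finset (Finset V)) :
    L → Finset V → Prop :=
  fun E' e => rel E' e ∨ (E' = E ∧ e ∈ F)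

theorem delta_addEdges [DecidableEq V] {rel : L → Finset V → Prop} {E : L}
    {F : Finset (Finset V)}
    (h : ∀ e ∈ F, ¬ rel E e) (A : Finset V) :
    delta α (addEdges rel E F) A = delta α rel A - α E * ((F.filter (· ⊆ A)).card : ℝ) := by
  classical
  have key : ∀ E', (edgeCount (addEdges rel E F) E' A : ℝ)
      = edgeCount rel E' A + if E' = E then ((F.filter (· ⊆ A)).card : ℝ) else 0 := by
    intro E'
    by_cases hE : E' = E
    · subst hE
      rw [if_pos rfl]
      have : edgeCount (addEdges rel E' F) E' A
          = edgeCount rel E' A + (F.filter (· ⊆ A)).card := by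
        unfold edgeCount
        rw [← Set.ncard_coe_finset, ← Set.ncard_union_eq ?_ (edgeSet_finite rel E' A)
          (Finset.finite_toSet _)]
        · congr 1
          ext e
          simp only [addEdges, Set.mem_ofPred_eq, Set.mem_union, Finset.mem_coe,
            Finset.mem_filter]
          tauto
        · rw [Set.disjoint_left]
          intro e he he'
          simp only [Finset.mem_coe, Finset.mem_filter] at he'
          exact h e he'.1 he.2
      exact_mod_cast this
    · rw [if_neg hE, add_zero]
      congr 1
      apply edgeCount_congr
      intro e _
      simp [addEdges, hE]
  unfold delta
  simp only [key, mul_add, Finset.sum_add_distrib, mul_ite, mul_zero, Finset.sum_ite_eq',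
    Finset.mem_univ, if_true]
  ring

theorem delta_eq_add_card_sdiff [DecidableEq V] {rel : L → Finset V → Prop} {A B : Finset V}
    (hAB : A ⊆ B) (h : ∀ E e, e ⊆ B → rel E e → e ⊆ A) :
    delta α rel B = delta α rel A + ((B \ A).card : ℝ) := by
  have key : ∀ E, edgeCount rel E B = edgeCount rel E A := by
    intro E
    unfold edgeCount
    congr 1
    ext e
    simp only [Set.mem_ofPred_eq]
    constructor
    · exact fun he => ⟨h E e he.1 he.2, he.2⟩
    · exact fun he => ⟨he.1.trans hAB, he.2⟩
  unfold delta
  simp only [key]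
  have : ((B \ A).card : ℝ) + A.card = B.card := by
    exact_mod_cast Finset.card_sdiff_add_card_eq_card hAB
  linarith

theorem delta_join [DecidableEq V] {ar : L → ℕ} (har : ∀ E, 2 ≤ ar E)
    {rel₁ rel₂ : L → Finset V → Prop} {B D : Finset V} (hBD : Disjoint B D)
    (h₁ : supportedOn ar rel₁ B) (h₂ : supportedOn ar rel₂ D) {X Y : Finset V}
    (hX : X ⊆ B) (hY : Y ⊆ D) :
    delta α (fun E e => rel₁ E e ∨ rel₂ E e) (X ∪ Y) = delta α rel₁ X + delta α rel₂ Y := by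
  have key : ∀ E, edgeCount (fun E e => rel₁ E e ∨ rel₂ E e) E (X ∪ Y)
      = edgeCount rel₁ E X + edgeCount rel₂ E Y := by
    intro E
    unfold edgeCount
    rw [← Set.ncard_union_eq ?_ (edgeSet_finite rel₁ E X) (edgeSet_finite rel₂ E Y)]
    · congr 1
      ext e
      simp only [Set.mem_ofPred_eq, Set.mem_union]
      constructor
      · rintro ⟨he, h | h⟩
        · left
          refine ⟨fun z hz => ?_, h⟩
          rcases Finset.mem_union.1 (he hz) with h' | h'
          · exact h'
          · exact absurd (hY h') (Finset.disjoint_left.1 hBD ((h₁ E e h).1 hz))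
        · right
          refine ⟨fun z hz => ?_, h⟩
          rcases Finset.mem_union.1 (he hz) with h' | h'
          · exact absurd ((h₂ E e h).1 hz) (Finset.disjoint_left.1 hBD (hX h'))
          · exact h'
      · rintro (⟨he, h⟩ | ⟨he, h⟩)
        · exact ⟨he.trans subset_union_left, Or.inl h⟩
        · exact ⟨he.trans subset_union_right, Or.inr h⟩
    · rw [Set.disjoint_left]
      rintro e ⟨he, h⟩ ⟨he', h'⟩
      have hc := (h₁ E e h).2
      have := har E
      obtain ⟨z, hz⟩ : e.Nonempty := Finset.card_pos.1 (by omega)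
      exact Finset.disjoint_left.1 hBD ((h₁ E e h).1 hz) ((h₂ E e h').1 hz)
  have hd : Disjoint X Y :=
    Finset.disjoint_of_subset_left hX (Finset.disjoint_of_subset_right hY hBD)
  unfold delta
  simp only [key, Finset.card_union_of_disjoint hd, Nat.cast_add, mul_add, Finset.sum_add_distrib]
  ring

/-- Ranks relative to `C` of extensions of bounded size cannot be negative and close to `0`. -/
theorem exists_delta_gap (hα : ∀ E, 0 < α E) (t : ℕ) :
    ∃ η : ℝ, 0 < η ∧ ∀ (V : Type) (rel : L → Finset V → Prop) (C X : Finset V), C ⊆ X →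
      X.card ≤ C.card + t → delta α rel X < delta α rel C →
      delta α rel X + η ≤ delta α rel C := by
  classical
  obtain ⟨N, hN⟩ : ∃ N : ℕ, ∀ E, (t + 1 : ℝ) ≤ N * α E := by
    choose n hn using fun E => exists_nat_ge ((t + 1 : ℝ) / α E)
    refine ⟨∑ E, n E, fun E => ?_⟩
    have h1 : (t + 1 : ℝ) ≤ n E * α E := (div_le_iff₀ (hα E)).1 (hn E)
    have h2 : n E ≤ ∑ E, n E := Finset.single_le_sum (f := n) (fun _ _ => Nat.zero_le _)
      (Finset.mem_univ E)
    have h3 : (n E : ℝ) ≤ ((∑ E, n E : ℕ) : ℝ) := by exact_mod_cast h2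
    nlinarith [hα E]
  let vals : Finset ℝ :=
    ((Finset.range (t + 1) ×ˢ Fintype.piFinset (fun _ : L => Finset.range (N + 1))).image
      (fun p => ∑ E, α E * (p.2 E : ℝ) - p.1)).filter (0 < ·)
  obtain ⟨η, hη0, hη⟩ : ∃ η : ℝ, (0 < η ∧ η ≤ 1) ∧ ∀ x ∈ vals, η ≤ x := by
    by_cases hne : vals.Nonempty
    · refine ⟨min 1 (vals.min' hne), ⟨lt_min one_pos ?_, min_le_left _ _⟩, fun x hx =>
        (min_le_right _ _).trans (vals.min'_le x hx)⟩
      exact (Finset.mem_filter.1 (vals.min'_mem hne)).2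
    · refine ⟨1, ⟨one_pos, le_rfl⟩, fun x hx => absurd ⟨x, hx⟩ hne⟩
  refine ⟨η, hη0.1, fun V rel C X hCX hcard hlt => ?_⟩
  have hmono : ∀ E, edgeCount rel E C ≤ edgeCount rel E X := fun E =>
    Set.ncard_le_ncard (fun e he => ⟨he.1.trans hCX, he.2⟩) (edgeSet_finite rel E X)
  let m : L → ℕ := fun E => edgeCount rel E X - edgeCount rel E C
  have hc : C.card ≤ X.card := Finset.card_le_card hCX
  have hm : ∀ E, (m E : ℝ) = edgeCount rel E X - edgeCount rel E C := fun E =>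
    Nat.cast_sub (hmono E)
  have hval : delta α rel C - delta α rel X =
      ∑ E, α E * (m E : ℝ) - ((X.card - C.card : ℕ) : ℝ) := by
    unfold delta
    simp only [hm, mul_sub, Finset.sum_sub_distrib, Nat.cast_sub hc]
    ring
  by_cases hle : ∀ E, m E ≤ N
  · have : delta α rel C - delta α rel X ∈ vals := by
      refine Finset.mem_filter.2 ⟨Finset.mem_image.2 ⟨(X.card - C.card, m), ?_, hval.symm⟩,
        by linarith⟩
      simp only [Finset.mem_product, Finset.mem_range, Fintype.mem_piFinset]
      exact ⟨by omega, fun E => by have := hle E; omega⟩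
    linarith [hη _ this]
  · push Not at hle
    obtain ⟨E, hE⟩ := hle
    have h1 : α E * (m E : ℝ) ≤ ∑ E, α E * (m E : ℝ) :=
      Finset.single_le_sum (f := fun E => α E * (m E : ℝ))
        (fun E _ => mul_nonneg (hα E).le (Nat.cast_nonneg _)) (Finset.mem_univ E)
    have h2 : (N : ℝ) ≤ m E := by exact_mod_cast hE.le
    have h3 : ((X.card - C.card : ℕ) : ℝ) ≤ t := by
      have : X.card - C.card ≤ t := by omega
      exact_mod_cast this
    have h4 := hN E
    nlinarith [hα E, hη0.2]

end Rank

section Arithmetic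

theorem exists_seed_size {a : ℝ} (ha : 0 < a) (ha1 : a ≤ 1) {r : ℕ} (hr : 2 ≤ r) :
    ∃ s k : ℕ, 1 ≤ s ∧ k ≤ s.choose r ∧ 0 ≤ s - a * k ∧ s - a * k < a ∧
      (∀ q : ℕ, 1 ≤ q → q < s → a ≤ q - a * (q.choose r : ℝ)) ∧
      2 ≤ a * (s.choose (r - 1) : ℝ) := by
  classical
  have hex : ∃ s : ℕ, 1 ≤ s ∧ (s : ℝ) - a * (s.choose r : ℝ) < a := by
    have hch : ∀ j n : ℕ, n.choose 2 ≤ (n + j).choose (2 + j) := by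
      intro j n
      induction j with
      | zero => simp
      | succ j ih =>
        refine ih.trans ?_
        rw [show n + (j + 1) = (n + j) + 1 by ring, show 2 + (j + 1) = (2 + j) + 1 by ring,
          Nat.choose_succ_succ]
        exact Nat.le_add_right _ _
    obtain ⟨n, hn⟩ := exists_nat_ge (2 * (r + 2) / a + 2)
    have hn2 : 2 ≤ n := by
      have h0 := div_nonneg (by positivity : (0 : ℝ) ≤ 2 * (r + 2)) ha.le
      have : (2 : ℝ) ≤ n := by linarith
      exact_mod_cast this
    refine ⟨n + (r - 2), by omega, ?_⟩
    have h1 := hch (r - 2) n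
    rw [show 2 + (r - 2) = r by omega] at h1
    have h2 : ((n.choose 2 : ℕ) : ℝ) = n * (n - 1) / 2 := Nat.cast_choose_two ℝ n
    have h3 : (n : ℝ) * (n - 1) / 2 ≤ ((n + (r - 2)).choose r : ℕ) := by
      rw [← h2]; exact_mod_cast h1
    have h4 : ((n + (r - 2) : ℕ) : ℝ) = n + r - 2 := by
      push_cast [Nat.cast_sub hr]; ring
    rw [h4]
    have h5 : 2 * ((r : ℝ) + 2) ≤ a * (n - 2) := by
      have : 2 * ((r : ℝ) + 2) / a ≤ n - 2 := by linarith
      rw [div_le_iff₀ ha] at this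
      linarith
    have hn2' : (2 : ℝ) ≤ n := by exact_mod_cast hn2
    have hr' : (2 : ℝ) ≤ r := by exact_mod_cast hr
    have h6 : a * (n * (n - 1) / 2) ≤ a * ((n + (r - 2)).choose r : ℕ) :=
      mul_le_mul_of_nonneg_left h3 ha.le
    have h7 : 2 * ((r : ℝ) + 2) * (n / 2) ≤ a * (n - 2) * (n / 2) :=
      mul_le_mul_of_nonneg_right h5 (by linarith)
    nlinarith
  obtain ⟨s, ⟨hs1, hs2⟩, hmin⟩ : ∃ s : ℕ, (1 ≤ s ∧ (s : ℝ) - a * (s.choose r : ℝ) < a) ∧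
      ∀ q < s, ¬ (1 ≤ q ∧ (q : ℝ) - a * (q.choose r : ℝ) < a) :=
    ⟨Nat.find hex, Nat.find_spec hex, fun q hq => Nat.find_min hex hq⟩
  have hfl : (⌊(s : ℝ) / a⌋₊ : ℝ) ≤ s / a := Nat.floor_le (by positivity)
  have hfl' : (s : ℝ) / a < ⌊(s : ℝ) / a⌋₊ + 1 := Nat.lt_floor_add_one _
  rw [le_div_iff₀ ha] at hfl
  rw [div_lt_iff₀ ha] at hfl'
  refine ⟨s, ⌊(s : ℝ) / a⌋₊, hs1, ?_, by linarith, by linarith, ?_, ?_⟩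
  · have : (⌊(s : ℝ) / a⌋₊ : ℝ) < s.choose r + 1 := by
      have : (⌊(s : ℝ) / a⌋₊ : ℝ) * a < (s.choose r + 1) * a := by linarith
      exact lt_of_mul_lt_mul_right this ha.le
    have h' : ⌊(s : ℝ) / a⌋₊ < s.choose r + 1 := by exact_mod_cast this
    omega
  · intro q hq hqs
    by_contra hlt
    exact hmin q hqs ⟨hq, not_le.1 hlt⟩
  · obtain ⟨k, rfl⟩ : ∃ k, r = k + 1 := ⟨r - 1, by omega⟩
    have hk : 1 ≤ k := by omega
    rw [Nat.add_sub_cancel]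
    have hmul := Nat.choose_succ_right_eq s k
    have hk' : (1 : ℝ) ≤ k := by exact_mod_cast hk
    have hs' : (1 : ℝ) ≤ s := by exact_mod_cast hs1
    by_cases hsk : k < s
    · have hmul' : (s.choose (k + 1) : ℝ) * (k + 1) = s.choose k * (s - k) := by
        have := congrArg (Nat.cast : ℕ → ℝ) hmul
        push_cast [Nat.cast_sub hsk.le] at this
        exact this
      have hsk' : (0 : ℝ) < s - k := by
        have : (k : ℝ) < s := by exact_mod_cast hsk
        linarith
      by_contra hlt
      push Not at hlt
      have h1 : a * (s.choose (k + 1) : ℝ) * (k + 1) = a * s.choose k * (s - k) := by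
        rw [mul_assoc, hmul', mul_assoc]
      have h2 : ((s : ℝ) - 1) * (k + 1) < a * (s.choose (k + 1) : ℝ) * (k + 1) :=
        mul_lt_mul_of_pos_right (by linarith) (by linarith)
      have h3 : a * (s.choose k : ℝ) * (s - k) < 2 * (s - k) :=
        mul_lt_mul_of_pos_right hlt hsk'
      nlinarith
    · have h0 : s.choose (k + 1) = 0 := Nat.choose_eq_zero_of_lt (by omega)
      rw [h0] at hs2
      simp at hs2
      linarith

variable {L : Type}

/-- The sum of `1 - α E` over the letters `E` of a word. -/
def wordSum (α : L → ℝ) (w : List L) : ℝ := (w.map (fun E => 1 - α E)).sum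

theorem wordSum_append (α : L → ℝ) (w w' : List L) :
    wordSum α (w ++ w') = wordSum α w + wordSum α w' := by
  simp [wordSum]

theorem wordSum_cons (α : L → ℝ) (E : L) (w : List L) :
    wordSum α (E :: w) = 1 - α E + wordSum α w := by
  simp [wordSum]

theorem exists_wordSum_eq_mul (α : L → ℝ) (w : List L) (n : ℕ) :
    ∃ w', wordSum α w' = n * wordSum α w := by
  induction n with
  | zero => exact ⟨[], by simp [wordSum]⟩
  | succ n ih =>
    obtain ⟨w', hw'⟩ := ih
    exact ⟨w' ++ w, by rw [wordSum_append, hw']; push_cast; ring⟩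

theorem wordSum_mem_rankGroup (α : L → ℝ) (w : List L) : wordSum α w ∈ rankGroup α := by
  induction w with
  | nil => simp [wordSum, zero_mem]
  | cons E w ih =>
    rw [wordSum_cons]
    refine add_mem (sub_mem ?_ ?_) ih
    · exact AddSubgroup.subset_closure (Set.mem_insert _ _)
    · exact AddSubgroup.subset_closure (Set.mem_insert_of_mem _ ⟨E, rfl⟩)

theorem exists_wordSum_near {α : L → ℝ} {E₀ : L} (h0 : 0 < α E₀) {h : ℝ}
    (hh : h ∈ rankGroup α) :
    ∀ η : ℝ, 0 < η → ∃ (w : List L) (z : ℤ), |wordSum α w - h - z * α E₀| < η := by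
  let p : ℝ → Prop := fun h =>
    ∀ η : ℝ, 0 < η → ∃ (w : List L) (z : ℤ), |wordSum α w - h - z * α E₀| < η
  have hadd : ∀ x y, p x → p y → p (x + y) := by
    intro x y hx hy η hη
    obtain ⟨w, z, hw⟩ := hx (η / 2) (by linarith)
    obtain ⟨w', z', hw'⟩ := hy (η / 2) (by linarith)
    refine ⟨w ++ w', z + z', ?_⟩
    rw [wordSum_append]
    push_cast
    rw [abs_lt] at *
    constructor <;> linarith [hw.1, hw.2, hw'.1, hw'.2]
  have hneg : ∀ x, p x → p (-x) := by
    intro x hx η hη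
    obtain ⟨w, z, hw⟩ := hx (η / 2) (by linarith)
    obtain ⟨n, hn⟩ := exists_nat_gt (2 * α E₀ / η)
    have hn0 : 0 < n := by
      have : (0 : ℝ) < n := lt_of_le_of_lt (by positivity) hn
      exact_mod_cast this
    obtain ⟨q, hq0, -, hq⟩ := Real.exists_nat_abs_mul_sub_round_le (wordSum α w / α E₀) hn0
    obtain ⟨w', hw'⟩ := exists_wordSum_eq_mul α w (q - 1)
    refine ⟨w', round ((q : ℝ) * (wordSum α w / α E₀)) - z, ?_⟩
    have h1 : |(q : ℝ) * wordSum α w - round ((q : ℝ) * (wordSum α w / α E₀)) * α E₀| < η / 2 := by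
      have h2 : (q : ℝ) * wordSum α w - round ((q : ℝ) * (wordSum α w / α E₀)) * α E₀
          = ((q : ℝ) * (wordSum α w / α E₀) - round ((q : ℝ) * (wordSum α w / α E₀))) * α E₀ := by
        field_simp
      rw [h2, abs_mul, abs_of_pos h0]
      have h3 : (1 : ℝ) / (n + 1) * α E₀ < η / 2 := by
        rw [div_lt_iff₀ hη] at hn
        rw [div_mul_eq_mul_div, div_lt_iff₀ (by positivity)]
        nlinarith
      calc _ ≤ (1 : ℝ) / (n + 1) * α E₀ := mul_le_mul_of_nonneg_right hq h0.le
        _ < _ := h3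
    rw [hw', Nat.cast_sub hq0]
    push_cast
    rw [abs_lt] at *
    constructor <;> linarith [hw.1, hw.2, h1.1, h1.2]
  have hone : p 1 := fun η hη => ⟨[E₀], -1, by simp [wordSum, hη]⟩
  change p h
  refine AddSubgroup.closure_induction (p := fun x _ => p x) ?_ ?_ (fun x y _ _ => hadd x y)
    (fun x _ => hneg x) hh
  · rintro x (rfl | ⟨E, rfl⟩)
    · exact hone
    · have h1 : p (1 - α E) := fun η hη => ⟨[E], 0, by simp [wordSum, hη]⟩
      have := hadd _ _ hone (hneg _ h1)
      simpa using this
  · exact fun η hη => ⟨[], 0, by simp [wordSum, hη]⟩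

variable [Fintype L]

/-- The representative of `t` modulo `a` in `[0, a)`. -/
noncomputable def residue (a t : ℝ) : ℝ := a * Int.fract (t / a)

theorem residue_nonneg {a : ℝ} (ha : 0 < a) (t : ℝ) : 0 ≤ residue a t :=
  mul_nonneg ha.le (Int.fract_nonneg _)

theorem residue_lt {a : ℝ} (ha : 0 < a) (t : ℝ) : residue a t < a := by
  have := mul_lt_mul_of_pos_left (Int.fract_lt_one (t / a)) ha
  simpa [residue] using this

theorem residue_eq {a : ℝ} (ha : 0 < a) (t : ℝ) : residue a t = t - ⌊t / a⌋ * a := by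
  unfold residue
  rw [Int.fract, mul_sub, mul_div_cancel₀ _ ha.ne']
  ring

theorem residue_eq_of_mem {a : ℝ} (ha : 0 < a) {t x : ℝ} (z : ℤ) (h : t = x + z * a)
    (hx : 0 ≤ x) (hxa : x < a) : residue a t = x := by
  rw [residue_eq ha]
  have : ⌊t / a⌋ = z := by
    rw [Int.floor_eq_iff, le_div_iff₀ ha, div_lt_iff₀ ha]
    constructor <;> nlinarith
  rw [this]
  linarith

/-- The residues at all proper tails of `w` are at most `M`, and the letters of `w` occur late
enough for their arities. -/
def admissible (α : L → ℝ) (ar : L → ℕ) (a ζ : ℝ) (s : ℕ) (M : ℝ) (w : List L) : Prop :=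
  ∀ E w', (E :: w') <:+ w → residue a (ζ + wordSum α w') ≤ M ∧ ar E ≤ w'.length + s + 1

theorem exists_lt_forall_lt {a : ℝ} (l : List ℝ) (h : ∀ x ∈ l, x < a) :
    ∃ c < a, ∀ x ∈ l, x < c := by
  induction l with
  | nil => exact ⟨a - 1, by linarith, by simp⟩
  | cons y l ih =>
    obtain ⟨c, hc, hl⟩ := ih fun x hx => h x (List.mem_cons_of_mem _ hx)
    have hy := h y List.mem_cons_self
    refine ⟨max c ((y + a) / 2), max_lt hc (by linarith), fun x hx => ?_⟩
    rcases List.mem_cons.1 hx with rfl | hx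
    · exact lt_of_lt_of_le (by linarith) (le_max_right _ _)
    · exact lt_of_lt_of_le (hl x hx) (le_max_left _ _)

theorem exists_word {α : L → ℝ} {ar : L → ℕ} {E₀ : L} (h0 : 0 < α E₀) {ζ : ℝ}
    (hζ : ζ ∈ rankGroup α) {s : ℕ} (hs : ar E₀ ≤ s + 1) (k : ℕ) {η : ℝ} (hη : 0 < η) :
    ∃ (u : ℝ) (w : List L), 0 < u ∧ k ≤ w.length ∧
      admissible α ar (α E₀) ζ s (α E₀ - u) w ∧
      residue (α E₀) (ζ + wordSum α w) = α E₀ - u ∧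
      ∀ h ∈ rankGroup α, η ≤ h → u ≤ h := by
  classical
  obtain ⟨N, hkN, hN⟩ : ∃ N, k ≤ N ∧ ∀ E, ar E ≤ N :=
    ⟨k + ∑ E, ar E, Nat.le_add_right _ _, fun E =>
      (Finset.single_le_sum (f := ar) (fun _ _ => Nat.zero_le _) (Finset.mem_univ E)).trans
        (Nat.le_add_left _ _)⟩
  have har : ∀ w₁ E w', (E :: w') <:+ (w₁ ++ List.replicate N E₀) → ar E ≤ w'.length + s + 1 := by
    intro w₁ E w' hw'
    by_cases hl : N ≤ w'.length
    · exact (hN E).trans (by omega)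
    · have : (E :: w') <:+ List.replicate N E₀ :=
        List.suffix_of_suffix_length_le hw' (List.suffix_append _ _) (by simp; omega)
      have hE : E = E₀ := List.eq_of_mem_replicate (this.subset List.mem_cons_self)
      subst hE
      omega
  rcases AddSubgroup.dense_or_cyclic (rankGroup α) with hd | ⟨c, hc⟩
  · obtain ⟨c₀, hc₀, hlow⟩ := exists_lt_forall_lt (a := α E₀)
      ((List.replicate N E₀).tails.map (fun w => residue (α E₀) (ζ + wordSum α w)))
      (by
        intro x hx
        obtain ⟨w, -, rfl⟩ := List.mem_map.1 hx
        exact residue_lt h0 _)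
    obtain ⟨c, hc0, hcη, hcc₀, hca⟩ : ∃ c, 0 ≤ c ∧ α E₀ - η ≤ c ∧ c₀ ≤ c ∧ c < α E₀ :=
      ⟨max 0 (max (α E₀ - η) c₀), le_max_left _ _, (le_max_left _ _).trans (le_max_right _ _),
        (le_max_right _ _).trans (le_max_right _ _),
        max_lt h0 (max_lt (by linarith) hc₀)⟩
    obtain ⟨ε, hε⟩ : ∃ ε, ε = α E₀ - c := ⟨_, rfl⟩
    obtain ⟨h, hh, hhd⟩ := hd.exists_dist_lt
      (-(ζ + wordSum α (List.replicate N E₀)) - ε / 2) (show 0 < ε / 4 by linarith)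
    rw [Real.dist_eq] at hhd
    obtain ⟨w₁, z, hw₁⟩ := exists_wordSum_near h0 hh (ε / 4) (by linarith)
    have hex : ∃ n, ∃ w, w <:+ (w₁ ++ List.replicate N E₀) ∧ w.length = n ∧
        c ≤ residue (α E₀) (ζ + wordSum α w) := by
      refine ⟨_, _, List.suffix_refl _, rfl, ?_⟩
      rw [wordSum_append]
      have hr : residue (α E₀) (ζ + (wordSum α w₁ + wordSum α (List.replicate N E₀)))
          = ζ + (wordSum α w₁ + wordSum α (List.replicate N E₀)) - ((z - 1 : ℤ) : ℝ) * α E₀ := by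
        rw [abs_lt] at *
        apply residue_eq_of_mem h0 (z - 1) (by ring) <;> push_cast <;>
          linarith [hw₁.1, hw₁.2, hhd.1, hhd.2]
      rw [hr]
      rw [abs_lt] at *
      push_cast
      linarith [hw₁.1, hw₁.2, hhd.1, hhd.2]
    obtain ⟨w, hwsuf, hwlen, hwc⟩ := Nat.find_spec hex
    have hmin : ∀ w', w' <:+ (w₁ ++ List.replicate N E₀) → w'.length < w.length →
        residue (α E₀) (ζ + wordSum α w') < c := by
      intro w' hw' hlt
      by_contra hle
      exact Nat.find_min hex (hwlen ▸ hlt) ⟨w', hw', rfl, not_lt.1 hle⟩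
    refine ⟨α E₀ - residue (α E₀) (ζ + wordSum α w), w,
      by linarith [residue_lt h0 (ζ + wordSum α w)], ?_, ?_, by ring, ?_⟩
    · by_contra hlt
      have hsuf : w <:+ List.replicate N E₀ :=
        List.suffix_of_suffix_length_le hwsuf (List.suffix_append _ _) (by simp; omega)
      have := hlow _ (List.mem_map.2 ⟨w, (List.mem_tails _ _).2 hsuf, rfl⟩)
      linarith
    · intro E w' hw'
      refine ⟨?_, har w₁ E w' (hw'.trans hwsuf)⟩
      have := hmin w' ((List.suffix_cons _ _).trans (hw'.trans hwsuf)) (by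
        have := hw'.length_le
        simp at this
        omega)
      linarith
    · intro h _ hle
      linarith
  · have hmul : ∀ x ∈ rankGroup α, ∃ z : ℤ, x = z * c := by
      intro x hx
      rw [hc, AddSubgroup.mem_closure_singleton] at hx
      obtain ⟨z, hz⟩ := hx
      exact ⟨z, by simpa using hz.symm⟩
    obtain ⟨c, hc0, hcmem, hmul⟩ : ∃ c : ℝ, 0 < c ∧ c ∈ rankGroup α ∧
        ∀ x ∈ rankGroup α, ∃ z : ℤ, x = z * c := by
      have hcmem : c ∈ rankGroup α := hc ▸ AddSubgroup.subset_closure (Set.mem_singleton c)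
      rcases lt_trichotomy c 0 with hneg | h0' | hpos
      · refine ⟨-c, by linarith, neg_mem hcmem, fun x hx => ?_⟩
        obtain ⟨z, hz⟩ := hmul x hx
        exact ⟨-z, by push_cast; linarith⟩
      · obtain ⟨z, hz⟩ := hmul 1 (AddSubgroup.subset_closure (Set.mem_insert _ _))
        rw [h0', mul_zero] at hz
        exact absurd hz one_ne_zero
      · exact ⟨c, hpos, hcmem, hmul⟩
    have hpos : ∀ x ∈ rankGroup α, 0 < x → c ≤ x := by
      intro x hx hx0
      obtain ⟨z, rfl⟩ := hmul x hx
      have h1 : 0 < z := by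
        by_contra hle
        have : (z : ℝ) ≤ 0 := by exact_mod_cast not_lt.1 hle
        nlinarith
      have h2 : (1 : ℝ) ≤ z := by exact_mod_cast h1
      nlinarith
    have hα0 : α E₀ ∈ rankGroup α :=
      AddSubgroup.subset_closure (Set.mem_insert_of_mem _ ⟨E₀, rfl⟩)
    have hzmem : ∀ z : ℤ, (z : ℝ) * α E₀ ∈ rankGroup α := fun z => by
      have := zsmul_mem hα0 z
      simpa using this
    have hres : ∀ w, residue (α E₀) (ζ + wordSum α w) ≤ α E₀ - c := by
      intro w
      have h1 : α E₀ - residue (α E₀) (ζ + wordSum α w) ∈ rankGroup α := by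
        rw [residue_eq h0]
        exact sub_mem hα0 (sub_mem (add_mem hζ (wordSum_mem_rankGroup α w)) (hzmem _))
      have := hpos _ h1 (by linarith [residue_lt h0 (ζ + wordSum α w)])
      linarith
    have hh : -c - (ζ + wordSum α (List.replicate N E₀)) ∈ rankGroup α :=
      sub_mem (neg_mem hcmem) (add_mem hζ (wordSum_mem_rankGroup α _))
    obtain ⟨w₁, z, hw₁⟩ := exists_wordSum_near h0 hh c hc0
    have hzero : wordSum α w₁ - (-c - (ζ + wordSum α (List.replicate N E₀))) - z * α E₀ = 0 := by
      have hmem := sub_mem (sub_mem (wordSum_mem_rankGroup α w₁) hh) (hzmem z)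
      rw [abs_lt] at hw₁
      rcases lt_trichotomy (wordSum α w₁ - (-c - (ζ + wordSum α (List.replicate N E₀)))
        - z * α E₀) 0 with hl | he | hg
      · have := hpos _ (neg_mem hmem) (by linarith)
        linarith [hw₁.1]
      · exact he
      · have := hpos _ hmem hg
        linarith [hw₁.2]
    refine ⟨c, w₁ ++ List.replicate N E₀, hc0, by simp; omega, fun E w' hw' =>
      ⟨hres w', har w₁ E w' hw'⟩, ?_, fun h hh hle => hpos h hh (by linarith)⟩
    rw [wordSum_append]
    apply residue_eq_of_mem h0 (z - 1)
    · push_cast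
      linarith
    · linarith [hpos _ hα0 h0]
    · linarith

end Arithmetic

section Gadget

variable {L V : Type} [Fintype L] {α : L → ℝ} {ar : L → ℕ}

/-- The hypergraph `rel` on `D` has rank `v`, which is least among the subsets containing the
point `x`; such subsets with at most `n` points have rank at least `v - M + a`. -/
structure ChainState (α : L → ℝ) (ar : L → ℕ) (a M : ℝ) (rel : L → Finset V → Prop)
    (D : Finset V) (x : V) (v : ℝ) (n : ℕ) : Prop where
  supported : supportedOn ar rel D
  mem : x ∈ D
  rank_eq : delta α rel D = v
  nonneg : ∀ C ⊆ D, 0 ≤ delta α rel C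
  le : ∀ C ⊆ D, x ∈ C → v ≤ delta α rel C
  small : ∀ C ⊆ D, x ∈ C → n < C.card ∨ v - M + a ≤ delta α rel C

theorem ChainState.step [DecidableEq V] {E₀ E : L} {M : ℝ} {rel : L → Finset V → Prop}
    {D : Finset V}
    {x : V} {v : ℝ} {n : ℕ} (h : ChainState α ar (α E₀) M rel D x v n) (hr : ∀ E, 2 ≤ ar E)
    (h0 : 0 < α E₀) (hE : α E₀ ≤ α E) (hE1 : α E₀ ≤ 1) (hv : v < α E₀) (hvM : v ≤ M)
    (hch : 2 ≤ α E₀ * (D.card.choose (ar E₀ - 1) : ℝ)) (hcard : ar E ≤ D.card + 1)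
    {y : V} (hy : y ∉ D) {v' : ℝ} {m : ℕ} (hv' : v' = v + 1 - α E - m * α E₀) (hv0 : 0 ≤ v') :
    ∃ rel' : L → Finset V → Prop, ChainState α ar (α E₀) M rel' (insert y D) y v' (n + 1) := by
  have hxy : x ≠ y := fun e => hy (e ▸ h.mem)
  obtain ⟨Q, hQ, hQc⟩ : ∃ Q ⊆ D.erase x, Q.card = ar E - 2 := by
    apply Finset.exists_subset_card_eq
    rw [Finset.card_erase_of_mem h.mem]
    omega
  have hxQ : x ∉ Q := fun hx => Finset.notMem_erase x D (hQ hx)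
  have hQD : insert x Q ⊆ D :=
    Finset.insert_subset h.mem (hQ.trans (Finset.erase_subset _ _))
  have hm : m ≤ ((powersetCard (ar E₀ - 1) D).erase (insert x Q)).card := by
    have h1 := Finset.pred_card_le_card_erase (s := powersetCard (ar E₀ - 1) D) (a := insert x Q)
    rw [Finset.card_powersetCard] at h1
    have h2 : (m : ℝ) < D.card.choose (ar E₀ - 1) := by
      have : (m : ℝ) * α E₀ < D.card.choose (ar E₀ - 1) * α E₀ := by nlinarith
      exact lt_of_mul_lt_mul_right this h0.le
    have h3 : m < D.card.choose (ar E₀ - 1) := by exact_mod_cast h2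
    omega
  obtain ⟨P, hP, hPm⟩ := Finset.exists_subset_card_eq hm
  have hPD : ∀ p ∈ P, p ⊆ D ∧ p.card = ar E₀ - 1 ∧ p ≠ insert x Q := by
    intro p hp
    have := hP hp
    rw [Finset.mem_erase, Finset.mem_powersetCard] at this
    exact ⟨this.2.1, this.2.2, this.1⟩
  have hinj : Set.InjOn (fun p => insert y p) (P : Set (Finset V)) := by
    intro p hp q hq hpq
    have hp' : y ∉ p := fun hh => hy ((hPD p hp).1 hh)
    have hq' : y ∉ q := fun hh => hy ((hPD q hq).1 hh)
    have := congrArg (fun e => e.erase y) hpq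
    simpa [Finset.erase_insert hp', Finset.erase_insert hq'] using this
  let F : Finset (Finset V) := P.image (fun p => insert y p)
  have hFcard : F.card = m := by rw [Finset.card_image_of_injOn hinj, hPm]
  have hF : ∀ e ∈ F, ∃ p ⊆ D, p.card = ar E₀ - 1 ∧ p ≠ insert x Q ∧ e = insert y p := by
    intro e he
    obtain ⟨p, hp, rfl⟩ := Finset.mem_image.1 he
    exact ⟨p, (hPD p hp).1, (hPD p hp).2.1, (hPD p hp).2.2, rfl⟩
  let e0 : Finset V := insert y (insert x Q)
  have hynQ : y ∉ insert x Q := fun hh => hy (hQD hh)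
  let rel₁ := addEdges rel E {e0}
  let rel' := addEdges rel₁ E₀ F
  have hd1 : ∀ e ∈ ({e0} : Finset (Finset V)), ¬ rel E e := by
    intro e he hre
    rw [Finset.mem_singleton] at he
    subst he
    exact hy ((h.supported E _ hre).1 (Finset.mem_insert_self _ _))
  have hd2 : ∀ e ∈ F, ¬ rel₁ E₀ e := by
    intro e he hre
    obtain ⟨p, hpD, -, hpne, rfl⟩ := hF e he
    rcases hre with hre | ⟨-, hre⟩
    · exact hy ((h.supported E₀ _ hre).1 (Finset.mem_insert_self _ _))
    · rw [Finset.mem_singleton] at hre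
      have := congrArg (fun e => e.erase y) hre
      simp only [e0] at this
      rw [Finset.erase_insert (fun hh => hy (hpD hh)), Finset.erase_insert hynQ] at this
      exact hpne this
  have hδ : ∀ Z, delta α rel' Z = delta α rel Z
      - α E * ((({e0} : Finset (Finset V)).filter (· ⊆ Z)).card : ℝ)
      - α E₀ * ((F.filter (· ⊆ Z)).card : ℝ) := fun Z => by
    rw [delta_addEdges hd2, delta_addEdges hd1]
  have hδ0 : ∀ C ⊆ D, delta α rel' C = delta α rel C := by
    intro C hC
    apply delta_congr
    intro E' e he
    have hye : y ∉ e := fun hh => hy (hC (he hh))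
    constructor
    · rintro ((h1 | ⟨-, h1⟩) | ⟨-, h1⟩)
      · exact h1
      · rw [Finset.mem_singleton] at h1
        exact absurd (h1 ▸ Finset.mem_insert_self _ _) hye
      · obtain ⟨p, -, -, -, rfl⟩ := hF e h1
        exact absurd (Finset.mem_insert_self _ _) hye
    · exact fun h1 => Or.inl (Or.inl h1)
  have hδ1 : ∀ C ⊆ D, delta α rel (insert y C) = delta α rel C + 1 := by
    intro C hC
    have hyC : y ∉ C := fun hh => hy (hC hh)
    rw [delta_eq_add_card_sdiff (Finset.subset_insert y C)]
    · rw [Finset.card_sdiff_of_subset (Finset.subset_insert y C), Finset.card_insert_of_notMem hyC]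
      simp
    · intro E' e he hre z hz
      rcases Finset.mem_insert.1 (he hz) with rfl | hz'
      · exact absurd ((h.supported _ _ hre).1 hz) hy
      · exact hz'
  have hcount : ∀ Z, α E₀ * ((F.filter (· ⊆ Z)).card : ℝ) ≤ m * α E₀ := by
    intro Z
    rw [mul_comm]
    apply mul_le_mul_of_nonneg_right _ h0.le
    rw [← hFcard]
    exact_mod_cast Finset.card_filter_le _ _
  have hcount0 : ∀ Z, α E * ((({e0} : Finset (Finset V)).filter (· ⊆ Z)).card : ℝ) ≤ α E := by
    intro Z
    have : ((({e0} : Finset (Finset V)).filter (· ⊆ Z)).card : ℝ) ≤ 1 := by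
      exact_mod_cast (Finset.card_filter_le _ _).trans (by simp)
    nlinarith
  have hx : ∀ C ⊆ D, x ∈ C → delta α rel C + v' - v ≤ delta α rel' (insert y C) := by
    intro C hC hxC
    rw [hδ, hδ1 C hC]
    linarith [hcount (insert y C), hcount0 (insert y C)]
  have hnx : ∀ C ⊆ D, x ∉ C → v' - v + α E ≤ delta α rel' (insert y C) := by
    intro C hC hxC
    rw [hδ, hδ1 C hC]
    have : ({e0} : Finset (Finset V)).filter (· ⊆ insert y C) = ∅ := by
      rw [Finset.filter_eq_empty_iff]
      intro e he hsub
      rw [Finset.mem_singleton] at he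
      subst he
      have : x ∈ insert y C := hsub (by simp [e0])
      rcases Finset.mem_insert.1 this with h1 | h1
      · exact hxy h1
      · exact hxC h1
    rw [this]
    simp only [Finset.card_empty, Nat.cast_zero, mul_zero, sub_zero]
    linarith [hcount (insert y C), h.nonneg C hC]
  have hcase : ∀ Z ⊆ insert y D, y ∈ Z → ∃ C ⊆ D, y ∉ C ∧ Z = insert y C := by
    intro Z hZ hyZ
    refine ⟨Z.erase y, ?_, Finset.notMem_erase _ _, (Finset.insert_erase hyZ).symm⟩
    rwa [← Finset.subset_insert_iff]
  have hle : ∀ Z ⊆ insert y D, y ∈ Z → v' ≤ delta α rel' Z := by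
    intro Z hZ hyZ
    obtain ⟨C, hC, -, rfl⟩ := hcase Z hZ hyZ
    by_cases hxC : x ∈ C
    · linarith [hx C hC hxC, h.le C hC hxC]
    · linarith [hnx C hC hxC]
  refine ⟨rel', ?_, Finset.mem_insert_self _ _, ?_, ?_, hle, ?_⟩
  · rintro E' e ((h1 | ⟨rfl, h1⟩) | ⟨rfl, h1⟩)
    · exact ⟨(h.supported _ _ h1).1.trans (Finset.subset_insert _ _), (h.supported _ _ h1).2⟩
    · rw [Finset.mem_singleton] at h1
      subst h1
      refine ⟨Finset.insert_subset_insert _ hQD, ?_⟩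
      rw [Finset.card_insert_of_notMem hynQ, Finset.card_insert_of_notMem hxQ, hQc]
      have := hr E'
      omega
    · obtain ⟨p, hpD, hpc, -, rfl⟩ := hF e h1
      refine ⟨Finset.insert_subset_insert _ hpD, ?_⟩
      rw [Finset.card_insert_of_notMem (fun hh => hy (hpD hh)), hpc]
      have := hr E'
      omega
  · rw [hδ, hδ1 D subset_rfl, h.rank_eq, Finset.filter_true_of_mem, Finset.filter_true_of_mem,
      hFcard]
    · simp only [Finset.card_singleton, Nat.cast_one]
      linarith
    · intro e he
      obtain ⟨p, hpD, -, -, rfl⟩ := hF e he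
      exact Finset.insert_subset_insert _ hpD
    · intro e he
      rw [Finset.mem_singleton] at he
      subst he
      exact Finset.insert_subset_insert _ hQD
  · intro Z hZ
    by_cases hyZ : y ∈ Z
    · exact hv0.trans (hle Z hZ hyZ)
    · have hZD : Z ⊆ D := (Finset.subset_insert_iff_of_notMem hyZ).1 hZ
      rw [hδ0 Z hZD]
      exact h.nonneg Z hZD
  · intro Z hZ hyZ
    obtain ⟨C, hC, hyC, rfl⟩ := hcase Z hZ hyZ
    by_cases hxC : x ∈ C
    · rcases h.small C hC hxC with h1 | h1
      · left
        rw [Finset.card_insert_of_notMem hyC]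
        omega
      · right
        linarith [hx C hC hxC]
    · right
      linarith [hnx C hC hxC]

theorem exists_chainState_seed [DecidableEq V] {E₀ : L} (hr : ∀ E, 2 ≤ ar E) {s k : ℕ} (hs : 1 ≤ s)
    (hk : k ≤ s.choose (ar E₀)) (h0 : 0 ≤ s - α E₀ * k) (ha : s - α E₀ * k < α E₀)
    (hsmall : ∀ q : ℕ, 1 ≤ q → q < s → α E₀ ≤ q - α E₀ * (q.choose (ar E₀) : ℝ)) (M : ℝ)
    {D : Finset V} (hD : D.card = s) :
    ∃ (rel : L → Finset V → Prop) (x : V),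
      ChainState α ar (α E₀) M rel D x (s - α E₀ * k) 0 := by
  obtain ⟨F, hF, hFc⟩ : ∃ F ⊆ powersetCard (ar E₀) D, F.card = k := by
    apply Finset.exists_subset_card_eq
    rwa [Finset.card_powersetCard, hD]
  obtain ⟨x, hx⟩ : D.Nonempty := Finset.card_pos.1 (by omega)
  have hFD : ∀ e ∈ F, e ⊆ D ∧ e.card = ar E₀ := fun e he => Finset.mem_powersetCard.1 (hF he)
  have hα0 : 0 < α E₀ := by linarith
  have hδ : ∀ C, delta α (addEdges (fun _ _ => False) E₀ F) C
      = C.card - α E₀ * ((F.filter (· ⊆ C)).card : ℝ) := by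
    intro C
    rw [delta_addEdges (by simp)]
    simp [delta, edgeCount]
  have hfull : delta α (addEdges (fun _ _ => False) E₀ F) D = s - α E₀ * k := by
    rw [hδ, hD, Finset.filter_true_of_mem fun e he => (hFD e he).1, hFc]
  have hne : ∀ C ⊆ D, C.Nonempty →
      s - α E₀ * k ≤ delta α (addEdges (fun _ _ => False) E₀ F) C := by
    intro C hC hCne
    rcases eq_or_ne C D with rfl | hCD
    · exact hfull.ge
    · have hlt : C.card < s := hD ▸ Finset.card_lt_card (hC.ssubset_of_ne hCD)
      have h1 := hsmall C.card hCne.card_pos hlt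
      have h2 : ((F.filter (· ⊆ C)).card : ℝ) ≤ C.card.choose (ar E₀) := by
        rw [← Finset.card_powersetCard]
        have : F.filter (· ⊆ C) ⊆ powersetCard (ar E₀) C := by
          intro e he
          rw [Finset.mem_filter] at he
          exact Finset.mem_powersetCard.2 ⟨he.2, (hFD e he.1).2⟩
        exact_mod_cast Finset.card_le_card this
      rw [hδ]
      nlinarith
  refine ⟨_, x, ⟨?_, hx, hfull, ?_, fun C hC hxC => hne C hC ⟨x, hxC⟩,
    fun C hC hxC => Or.inl (Finset.card_pos.2 ⟨x, hxC⟩)⟩⟩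
  · rintro E e (h | ⟨rfl, h⟩)
    · exact h.elim
    · exact hFD e h
  · intro C hC
    rcases C.eq_empty_or_nonempty with rfl | hCne
    · rw [hδ, (Finset.card_eq_zero (s := F.filter (· ⊆ ∅))).2]
      · simp
      · rw [Finset.filter_eq_empty_iff]
        intro e he hsub
        have h1 := (hFD e he).2
        have h2 := hr E₀
        rw [Finset.subset_empty.1 hsub] at h1
        simp at h1
        omega
    · exact h0.trans (hne C hC hCne)

theorem exists_chainState_word [DecidableEq V] {E₀ : L} (hr : ∀ E, 2 ≤ ar E) (h0 : 0 < α E₀)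
    (hmin : ∀ E, α E₀ ≤ α E) (hα1 : ∀ E, α E ≤ 1) {s : ℕ} {ζ M : ℝ}
    (hseed : ∀ D : Finset V, D.card = s →
      ∃ (rel : L → Finset V → Prop) (x : V), ChainState α ar (α E₀) M rel D x ζ 0)
    (hζ0 : 0 ≤ ζ) (hζa : ζ < α E₀) (hch : 2 ≤ α E₀ * (s.choose (ar E₀ - 1) : ℝ)) (w : List L) :
    admissible α ar (α E₀) ζ s M w → ∀ D : Finset V, D.card = s + w.length →
      ∃ (rel : L → Finset V → Prop) (x : V), ChainState α ar (α E₀) M rel D x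
        (residue (α E₀) (ζ + wordSum α w)) w.length := by
  induction w with
  | nil =>
    intro _ D hD
    rw [residue_eq_of_mem h0 0 (x := ζ) (by simp [wordSum]) hζ0 hζa]
    exact hseed D (by simpa using hD)
  | cons E w ih =>
    intro hadm D hD
    have hlast := hadm E w (List.suffix_refl _)
    obtain ⟨y, hy⟩ : D.Nonempty := Finset.card_pos.1 (by rw [hD]; simp)
    have hc : (D.erase y).card = s + w.length := by
      rw [Finset.card_erase_of_mem hy, hD]
      simp
    obtain ⟨rel, x, hst⟩ := ih (fun E' w' hw' => hadm E' w' (hw'.trans (List.suffix_cons _ _)))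
      (D.erase y) hc
    have hv := residue_lt h0 (ζ + wordSum α w)
    have hv0 := residue_nonneg h0 (ζ + wordSum α w)
    have hnn : 0 ≤ residue (α E₀) (ζ + wordSum α w) + 1 - α E := by linarith [hα1 E]
    have hm0 : (0 : ℝ) ≤ (residue (α E₀) (ζ + wordSum α w) + 1 - α E) / α E₀ :=
      div_nonneg hnn h0.le
    have hfl := Nat.floor_le hm0
    have hfl' := Nat.lt_floor_add_one ((residue (α E₀) (ζ + wordSum α w) + 1 - α E) / α E₀)
    rw [le_div_iff₀ h0] at hfl
    rw [div_lt_iff₀ h0] at hfl'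
    have hres : residue (α E₀) (ζ + wordSum α (E :: w))
        = residue (α E₀) (ζ + wordSum α w) + 1 - α E
          - ⌊(residue (α E₀) (ζ + wordSum α w) + 1 - α E) / α E₀⌋₊ * α E₀ := by
      apply residue_eq_of_mem h0 (⌊(ζ + wordSum α w) / α E₀⌋ +
        ⌊(residue (α E₀) (ζ + wordSum α w) + 1 - α E) / α E₀⌋₊)
      · rw [wordSum_cons]
        push_cast
        linarith [residue_eq h0 (ζ + wordSum α w)]
      · linarith
      · linarith
    have hmono : (s.choose (ar E₀ - 1) : ℝ) ≤ (D.erase y).card.choose (ar E₀ - 1) := by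
      rw [hc]
      exact_mod_cast Nat.choose_le_choose _ (Nat.le_add_right _ _)
    obtain ⟨rel', hstep⟩ := hst.step hr h0 (hmin E) (hα1 E₀) hv hlast.1
      (hch.trans (mul_le_mul_of_nonneg_left hmono h0.le)) (by rw [hc]; have := hlast.2; omega)
      (Finset.notMem_erase y D) hres (residue_nonneg h0 _)
    rw [Finset.insert_erase hy] at hstep
    exact ⟨rel', y, hstep⟩

/-- Arbitrarily large hypergraphs `D` with a distinguished set `F` of one point less than an
`E₀`-edge, in which attaching an `E₀`-edge along `F` lowers the rank by a small amount `u`, and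
small subsets do not notice. -/
theorem exists_gadget [Nonempty L] (hr : ∀ E, 2 ≤ ar E) (hα : ∀ E, 0 < α E ∧ α E ≤ 1) (k : ℕ)
    {η : ℝ} (hη : 0 < η) :
    ∃ (E₀ : L) (u : ℝ) (n : ℕ), 0 < u ∧ (∀ h ∈ rankGroup α, η ≤ h → u ≤ h) ∧
      ∀ {V : Type} [DecidableEq V] (D : Finset V), D.card = n →
        ∃ (rel : L → Finset V → Prop) (F : Finset V), supportedOn ar rel D ∧ F ⊆ D ∧
          F.card = ar E₀ - 1 ∧ (∀ C ⊆ D, 0 ≤ delta α rel C) ∧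
          (∀ C ⊆ D, F ⊆ C → α E₀ - u ≤ delta α rel C) ∧
          (∀ C ⊆ D, F ⊆ C → C.card ≤ k → α E₀ ≤ delta α rel C) ∧
          delta α rel D = α E₀ - u := by
  obtain ⟨E₀, hmin⟩ := Finite.exists_min α
  obtain ⟨s, m, hs, hm, hζ0, hζa, hsmall, hch⟩ := exists_seed_size (hα E₀).1 (hα E₀).2 (hr E₀)
  have hζ : (s : ℝ) - α E₀ * m ∈ rankGroup α := by
    have h1 := nsmul_mem (show (1 : ℝ) ∈ rankGroup α from
      AddSubgroup.subset_closure (Set.mem_insert _ _)) s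
    have h2 := nsmul_mem (show α E₀ ∈ rankGroup α from
      AddSubgroup.subset_closure (Set.mem_insert_of_mem _ ⟨E₀, rfl⟩)) m
    have := sub_mem h1 h2
    simpa [mul_comm] using this
  have hrs : ar E₀ - 1 ≤ s := by
    by_contra hlt
    rw [Nat.choose_eq_zero_of_lt (not_le.1 hlt)] at hch
    norm_num at hch
  obtain ⟨u, w, hu, hkw, hadm, hres, hmin'⟩ := exists_word (α := α) (ar := ar) (hα E₀).1 hζ
    (show ar E₀ ≤ s + 1 by omega) k hη
  refine ⟨E₀, u, s + w.length, hu, hmin', fun {V} _ D hD => ?_⟩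
  obtain ⟨rel, x, hst⟩ := exists_chainState_word (V := V) hr (hα E₀).1 hmin (fun E => (hα E).2)
    (fun D hD => exists_chainState_seed hr hs hm hζ0 hζa hsmall (α E₀ - u) hD) hζ0 hζa hch w
    hadm D hD
  obtain ⟨F, hxF, hFD, hFc⟩ : ∃ F : Finset V, {x} ⊆ F ∧ F ⊆ D ∧ F.card = ar E₀ - 1 :=
    Finset.exists_subsuperset_card_eq (Finset.singleton_subset_iff.2 hst.mem)
      (by have := hr E₀; simp; omega) (by omega)
  have hxC : ∀ C, F ⊆ C → x ∈ C := fun C hC => hC (hxF (Finset.mem_singleton_self x))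
  refine ⟨rel, F, hst.supported, hFD, hFc, hst.nonneg, fun C hC hFC => ?_, fun C hC hFC hCk => ?_,
    hst.rank_eq.trans hres⟩
  · exact hres ▸ hst.le C hC (hxC C hFC)
  · rcases hst.small C hC (hxC C hFC) with h1 | h1
    · omega
    · rw [hres] at h1
      linarith

end Gadget

section SmallExtension

variable {L : Type} [Fintype L] {α : L → ℝ} {ar : L → ℕ}

theorem exists_disjoint_card_eq {V : Type} [Infinite V] (B : Finset V) (n : ℕ) :
    ∃ D : Finset V, Disjoint B D ∧ D.card = n := by
  classical
  obtain ⟨D, hBD, hD⟩ := Infinite.exists_superset_card_eq B (B.card + n) (Nat.le_add_right _ _)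
  refine ⟨D \ B, Finset.disjoint_sdiff, ?_⟩
  rw [Finset.card_sdiff_of_subset hBD, hD]
  omega

/-- Attaching a gadget at a point `b` of `B`. -/
theorem exists_attach [Nonempty L] (hr : ∀ E, 2 ≤ ar E) (hα : ∀ E, 0 < α E ∧ α E ≤ 1) (k : ℕ)
    {η : ℝ} (hη : 0 < η) :
    ∃ (u : ℝ) (n : ℕ), 0 < u ∧ (∀ h ∈ rankGroup α, η ≤ h → u ≤ h) ∧
      ∀ {V : Type} [DecidableEq V] [Infinite V] (rel : L → Finset V → Prop) (B : Finset V),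
        supportedOn ar rel B → ∀ b ∈ B,
        ∃ (rel' : L → Finset V → Prop) (D : Finset V), Disjoint B D ∧ D.card = n ∧
          supportedOn ar rel' (B ∪ D) ∧ (∀ E, ∀ e ⊆ B, (rel' E e ↔ rel E e)) ∧
          (∀ X ⊆ B, ∀ Y ⊆ D, delta α rel X - u ≤ delta α rel' (X ∪ Y)) ∧
          (∀ X ⊆ B, ∀ Y ⊆ D, b ∉ X → delta α rel X ≤ delta α rel' (X ∪ Y)) ∧
          (∀ X ⊆ B, ∀ Y ⊆ D, Y.card ≤ k → delta α rel X ≤ delta α rel' (X ∪ Y)) ∧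
          (∀ X ⊆ B, b ∈ X → delta α rel' (X ∪ D) = delta α rel X - u) := by
  obtain ⟨E₀, u, n, hu, hmin, hg⟩ := exists_gadget hr hα k hη
  refine ⟨u, n, hu, hmin, fun {V} _ _ rel B hB b hb => ?_⟩
  obtain ⟨D, hBD, hDn⟩ := exists_disjoint_card_eq B n
  obtain ⟨relD, F, hD, hFD, hFc, hnn, hF, hFk, hfull⟩ := hg D hDn
  have hbD : b ∉ D := Finset.disjoint_left.1 hBD hb
  have hbF : b ∉ F := fun h => hbD (hFD h)
  have hr0 := hr E₀
  obtain ⟨z, hzF⟩ : F.Nonempty := Finset.card_pos.1 (by omega)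
  have hzB : z ∉ B := Finset.disjoint_right.1 hBD (hFD hzF)
  have hnew : ∀ e ∈ ({insert b F} : Finset (Finset V)), ¬ (rel E₀ e ∨ relD E₀ e) := by
    intro e he h
    rw [Finset.mem_singleton] at he
    subst he
    rcases h with h | h
    · exact hzB ((hB _ _ h).1 (Finset.mem_insert_of_mem hzF))
    · exact hbD ((hD _ _ h).1 (Finset.mem_insert_self _ _))
  have hform : ∀ X ⊆ B, ∀ Y ⊆ D,
      delta α (addEdges (fun E e => rel E e ∨ relD E e) E₀ {insert b F}) (X ∪ Y)
        = delta α rel X + delta α relD Y - if b ∈ X ∧ F ⊆ Y then α E₀ else 0 := by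
    intro X hX Y hY
    rw [delta_addEdges hnew, delta_join hr hBD hB hD hX hY]
    have hiff : insert b F ⊆ X ∪ Y ↔ b ∈ X ∧ F ⊆ Y := by
      rw [Finset.insert_subset_iff]
      constructor
      · rintro ⟨h1, h2⟩
        refine ⟨(Finset.mem_union.1 h1).resolve_right fun h => hbD (hY h), fun y hy => ?_⟩
        exact (Finset.mem_union.1 (h2 hy)).resolve_left fun h =>
          Finset.disjoint_left.1 hBD (hX h) (hFD hy)
      · exact fun h => ⟨Finset.mem_union_left _ h.1, h.2.trans Finset.subset_union_right⟩
    rw [Finset.filter_singleton]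
    by_cases h : b ∈ X ∧ F ⊆ Y
    · rw [if_pos h, if_pos (hiff.2 h)]
      simp
    · rw [if_neg h, if_neg (fun h' => h (hiff.1 h'))]
      simp
  refine ⟨addEdges (fun E e => rel E e ∨ relD E e) E₀ {insert b F}, D, hBD, hDn, ?_, ?_, ?_, ?_,
    ?_, ?_⟩
  · rintro E e ((h | h) | ⟨rfl, h⟩)
    · exact ⟨(hB _ _ h).1.trans Finset.subset_union_left, (hB _ _ h).2⟩
    · exact ⟨(hD _ _ h).1.trans Finset.subset_union_right, (hD _ _ h).2⟩
    · rw [Finset.mem_singleton] at h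
      subst h
      refine ⟨Finset.insert_subset (Finset.mem_union_left _ hb)
        (hFD.trans Finset.subset_union_right), ?_⟩
      rw [Finset.card_insert_of_notMem hbF]
      omega
  · intro E e he
    constructor
    · rintro ((h | h) | ⟨rfl, h⟩)
      · exact h
      · have h2 := (hD _ _ h).2
        have h3 := hr E
        obtain ⟨y, hy⟩ : e.Nonempty := Finset.card_pos.1 (by omega)
        exact absurd ((hD _ _ h).1 hy) (Finset.disjoint_left.1 hBD (he hy))
      · rw [Finset.mem_singleton] at h
        subst h
        exact absurd (he (Finset.mem_insert_of_mem hzF)) hzB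
    · exact fun h => Or.inl (Or.inl h)
  · intro X hX Y hY
    rw [hform X hX Y hY]
    split_ifs with h
    · linarith [hF Y hY h.2]
    · linarith [hnn Y hY]
  · intro X hX Y hY hbX
    rw [hform X hX Y hY, if_neg (fun h => hbX h.1)]
    linarith [hnn Y hY]
  · intro X hX Y hY hYk
    rw [hform X hX Y hY]
    split_ifs with h
    · linarith [hFk Y hY h.2 hYk]
    · linarith [hnn Y hY]
  · intro X hX hbX
    rw [hform X hX D subset_rfl, if_pos ⟨hbX, hFD⟩, hfull]
    ring

/-- `rel` on `B` extends `rel₀` on `B₀`, keeps `N` strong, and adding at most `k` points of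
`B` outside `B₀` does not lower ranks. -/
structure GoodExtension {V : Type} [DecidableEq V] (α : L → ℝ) (ar : L → ℕ) (k : ℕ)
    (rel₀ : L → Finset V → Prop) (N B₀ : Finset V) (rel : L → Finset V → Prop)
    (B : Finset V) : Prop where
  subset : B₀ ⊆ B
  supported : supportedOn ar rel B
  agree : ∀ E, ∀ e ⊆ B₀, (rel E e ↔ rel₀ E e)
  inK : inK α rel B
  strong : strong α rel N B
  le : ∀ X ⊆ B, (X \ B₀).card ≤ k → delta α rel (X ∩ B₀) ≤ delta α rel X

theorem GoodExtension.exists_step [Nonempty L] (hr : ∀ E, 2 ≤ ar E)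
    (hα : ∀ E, 0 < α E ∧ α E ≤ 1) (k : ℕ) {η : ℝ} (hη : 0 < η) :
    ∃ (u : ℝ) (n : ℕ), 0 < u ∧
      ∀ {V : Type} [DecidableEq V] [Infinite V] {rel₀ rel : L → Finset V → Prop}
        {N B₀ B : Finset V}, GoodExtension α ar k rel₀ N B₀ rel B →
        ∀ X ⊆ B, N ⊆ X → ∀ b ∈ X,
        (∀ Y ⊆ B, N ⊆ Y → b ∈ Y → delta α rel N + η ≤ delta α rel Y) →
        ∃ (rel' : L → Finset V → Prop) (B' : Finset V), GoodExtension α ar k rel₀ N B₀ rel' B' ∧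
          B ⊆ B' ∧ (∀ E, ∀ e ⊆ B, (rel' E e ↔ rel E e)) ∧ B'.card = B.card + n ∧
          ∃ X' ⊆ B', X ⊆ X' ∧ delta α rel' X' = delta α rel X - u := by
  obtain ⟨u, n, hu, hmin, hatt⟩ := exists_attach hr hα k hη
  refine ⟨u, n, hu, fun {V} _ _ {rel₀ rel N B₀ B} h X hXB hNX b hbX hlow => ?_⟩
  obtain ⟨rel', D, hBD, hDn, hsup, hagree, h1, h2, h3, h4⟩ := hatt rel B h.supported b (hXB hbX)
  have hlow' : ∀ Y ⊆ B, N ⊆ Y → b ∈ Y → delta α rel N + u ≤ delta α rel Y := by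
    intro Y hY hNY hbY
    have := hmin _ (sub_mem (delta_mem_rankGroup (α := α) rel Y)
      (delta_mem_rankGroup (α := α) rel N)) (by linarith [hlow Y hY hNY hbY])
    linarith
  have hδ : ∀ Y ⊆ B, delta α rel' Y = delta α rel Y := fun Y hY =>
    delta_congr fun E e he => hagree E e (he.trans hY)
  have hNB := h.strong.1
  have hsplit : ∀ Z ⊆ B ∪ D, Z = Z ∩ B ∪ Z ∩ D := by
    intro Z hZ
    rw [← Finset.inter_union_distrib_left, Finset.inter_eq_left.2 hZ]
  refine ⟨rel', B ∪ D, ⟨h.subset.trans Finset.subset_union_left, hsup, ?_, ?_, ?_, ?_⟩,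
    Finset.subset_union_left, hagree, ?_, X ∪ D, Finset.union_subset_union_left hXB,
    Finset.subset_union_left, h4 X hXB hbX⟩
  · exact fun E e he => (hagree E e (he.trans h.subset)).trans (h.agree E e he)
  · intro Z hZ
    rw [hsplit Z hZ]
    by_cases hb : b ∈ Z ∩ B
    · have hs := delta_submodular (fun E => (hα E).1.le) rel (Z ∩ B) N
      have hs1 := hlow' (Z ∩ B ∪ N) (Finset.union_subset Finset.inter_subset_right hNB)
        Finset.subset_union_right (Finset.mem_union_left _ hb)
      have hs2 := h.inK (Z ∩ B ∩ N) (Finset.inter_subset_right.trans hNB)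
      linarith [h1 (Z ∩ B) Finset.inter_subset_right (Z ∩ D) Finset.inter_subset_right]
    · exact (h.inK _ Finset.inter_subset_right).trans
        (h2 (Z ∩ B) Finset.inter_subset_right (Z ∩ D) Finset.inter_subset_right hb)
  · refine ⟨hNB.trans Finset.subset_union_left, fun Z hNZ hZ => ?_⟩
    have hNZB : N ⊆ Z ∩ B := Finset.subset_inter hNZ hNB
    rw [hsplit Z hZ, hδ N hNB]
    by_cases hb : b ∈ Z ∩ B
    · linarith [h1 (Z ∩ B) Finset.inter_subset_right (Z ∩ D) Finset.inter_subset_right,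
        hlow' (Z ∩ B) Finset.inter_subset_right hNZB hb]
    · exact (h.strong.2 _ hNZB Finset.inter_subset_right).trans
        (h2 (Z ∩ B) Finset.inter_subset_right (Z ∩ D) Finset.inter_subset_right hb)
  · intro Z hZ hZk
    have e1 : Z ∩ B ∩ B₀ = Z ∩ B₀ := by
      rw [Finset.inter_assoc, Finset.inter_eq_right.2 h.subset]
    have e2 : (Z ∩ D).card ≤ k := by
      refine (Finset.card_le_card fun z hz => ?_).trans hZk
      rw [Finset.mem_inter] at hz
      exact Finset.mem_sdiff.2 ⟨hz.1, fun hz' => Finset.disjoint_left.1 hBD (h.subset hz') hz.2⟩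
    have e3 : ((Z ∩ B) \ B₀).card ≤ k :=
      (Finset.card_le_card (Finset.sdiff_subset_sdiff Finset.inter_subset_left subset_rfl)).trans
        hZk
    have e4 := h.le (Z ∩ B) Finset.inter_subset_right e3
    rw [e1] at e4
    rw [hδ (Z ∩ B₀) (Finset.inter_subset_right.trans h.subset)]
    conv_rhs => rw [hsplit Z hZ]
    exact e4.trans (h3 _ Finset.inter_subset_right _ Finset.inter_subset_right e2)
  · rw [Finset.card_union_of_disjoint hBD, hDn]

/-- Given `b`, one can extend so that `b` lies in a superset of `N` of nearly the same rank. -/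
theorem GoodExtension.exists_near [Nonempty L] (hr : ∀ E, 2 ≤ ar E)
    (hα : ∀ E, 0 < α E ∧ α E ≤ 1) (k : ℕ) {η : ℝ} (hη : 0 < η) :
    ∃ T : ℕ, ∀ {V : Type} [DecidableEq V] [Infinite V] {rel₀ rel : L → Finset V → Prop}
        {N B₀ B : Finset V}, GoodExtension α ar k rel₀ N B₀ rel B → ∀ b ∈ B,
        ∃ (rel' : L → Finset V → Prop) (B' : Finset V), GoodExtension α ar k rel₀ N B₀ rel' B' ∧
          B ⊆ B' ∧ (∀ E, ∀ e ⊆ B, (rel' E e ↔ rel E e)) ∧ B'.card ≤ B.card + T ∧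
          ∃ X ⊆ B', N ⊆ X ∧ b ∈ X ∧ delta α rel' X < delta α rel' N + η := by
  obtain ⟨u, n, hu, hstep⟩ := GoodExtension.exists_step hr hα k hη
  have key : ∀ j : ℕ, ∀ {V : Type} [DecidableEq V] [Infinite V] {rel₀ rel : L → Finset V → Prop}
      {N B₀ B : Finset V}, GoodExtension α ar k rel₀ N B₀ rel B →
      ∀ X ⊆ B, N ⊆ X → ∀ b ∈ X, delta α rel X < delta α rel N + j * u →
      ∃ (rel' : L → Finset V → Prop) (B' : Finset V), GoodExtension α ar k rel₀ N B₀ rel' B' ∧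
        B ⊆ B' ∧ (∀ E, ∀ e ⊆ B, (rel' E e ↔ rel E e)) ∧ B'.card ≤ B.card + j * n ∧
        ∃ X ⊆ B', N ⊆ X ∧ b ∈ X ∧ delta α rel' X < delta α rel' N + η := by
    intro j
    induction j with
    | zero =>
      intro V _ _ rel₀ rel N B₀ B h X hX hNX b hb hlt
      have := h.strong.2 X hNX hX
      simp at hlt
      linarith
    | succ j ih =>
      intro V _ _ rel₀ rel N B₀ B h X hX hNX b hb hlt
      by_cases hex : ∃ Y ⊆ B, N ⊆ Y ∧ b ∈ Y ∧ delta α rel Y < delta α rel N + η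
      · exact ⟨rel, B, h, subset_rfl, fun _ _ _ => Iff.rfl, Nat.le_add_right _ _, hex⟩
      · push Not at hex
        obtain ⟨rel₁, B₁, h₁, hBB₁, hag₁, hc₁, X₁, hX₁, hXX₁, hδ₁⟩ :=
          hstep h X hX hNX b hb hex
        have hN : delta α rel₁ N = delta α rel N :=
          delta_congr fun E e he => hag₁ E e (he.trans h.strong.1)
        obtain ⟨rel', B', h', hB', hag', hc', hX'⟩ := ih h₁ X₁ hX₁ (hNX.trans hXX₁) b (hXX₁ hb)
          (by rw [hδ₁, hN]; push_cast at hlt; linarith)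
        refine ⟨rel', B', h', hBB₁.trans hB',
          fun E e he => (hag' E e (he.trans hBB₁)).trans (hag₁ E e he), ?_, hX'⟩
        rw [hc₁] at hc'
        rw [Nat.succ_mul]
        omega
  obtain ⟨J, hJ⟩ := exists_nat_gt (1 / u)
  rw [div_lt_iff₀ hu] at hJ
  refine ⟨J * n, fun {V} _ _ {rel₀ rel N B₀ B} h b hb => ?_⟩
  refine key J h (N ∪ {b}) (Finset.union_subset h.strong.1 (Finset.singleton_subset_iff.2 hb))
    Finset.subset_union_left b (by simp) ?_
  have h1 := delta_submodular (fun E => (hα E).1.le) rel N {b}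
  have h2 := delta_le_card (fun E => (hα E).1.le) rel {b}
  have h3 := h.inK (N ∩ {b}) (Finset.inter_subset_left.trans h.strong.1)
  simp only [Finset.card_singleton, Nat.cast_one] at h2
  linarith

/-- A strong extension `N ≤ B₀` extends to one of nearly the same rank as `N`, in such a way that
adding few points does not lower ranks over `B₀`. -/
theorem exists_near_extension [Nonempty L] (hr : ∀ E, 2 ≤ ar E)
    (hα : ∀ E, 0 < α E ∧ α E ≤ 1) (k p : ℕ) {η : ℝ} (hη : 0 < η) :
    ∃ T : ℕ, ∀ {V : Type} [DecidableEq V] [Infinite V] {rel₀ : L → Finset V → Prop}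
        {N B₀ : Finset V}, supportedOn ar rel₀ B₀ → inK α rel₀ B₀ → strong α rel₀ N B₀ →
        (B₀ \ N).card ≤ p →
        ∃ (rel : L → Finset V → Prop) (C : Finset V), B₀ ⊆ C ∧
          (∀ E e, rel E e → e.card = ar E) ∧ (∀ E, ∀ e ⊆ B₀, (rel E e ↔ rel₀ E e)) ∧
          inK α rel C ∧ strong α rel N C ∧ C.card ≤ B₀.card + T ∧
          delta α rel C < delta α rel N + η ∧
          ∀ X ⊆ C, (X \ B₀).card ≤ k → delta α rel (X ∩ B₀) ≤ delta α rel X := by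
  have hη' : 0 < η / (p + 1) := by positivity
  obtain ⟨T, hT⟩ := GoodExtension.exists_near hr hα k hη'
  refine ⟨p * T, fun {V} _ _ {rel₀ N B₀} hsup hK hN hp => ?_⟩
  have key : ∀ S : Finset V, S ⊆ B₀ → ∃ (rel : L → Finset V → Prop) (B X : Finset V),
      GoodExtension α ar k rel₀ N B₀ rel B ∧ B.card ≤ B₀.card + S.card * T ∧ X ⊆ B ∧ N ⊆ X ∧
        S ⊆ X ∧ delta α rel X ≤ delta α rel N + S.card * (η / (p + 1)) := by
    intro S
    induction S using Finset.induction_on with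
    | empty =>
      intro _
      refine ⟨rel₀, B₀, N, ⟨subset_rfl, hsup, fun _ _ _ => Iff.rfl, hK, hN, fun X hX _ => ?_⟩,
        by simp, hN.1, subset_rfl, Finset.empty_subset _, by simp⟩
      rw [Finset.inter_eq_left.2 hX]
    | insert b S hbS ih =>
      intro hS
      obtain ⟨rel, B, X, h, hc, hXB, hNX, hSX, hδ⟩ :=
        ih ((Finset.subset_insert _ _).trans hS)
      obtain ⟨rel', B', h', hBB', hag, hc', Y, hY, hNY, hbY, hδY⟩ :=
        hT h b (h.subset (hS (Finset.mem_insert_self _ _)))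
      have e1 : delta α rel' X = delta α rel X :=
        delta_congr fun E e he => hag E e (he.trans hXB)
      have e2 : delta α rel' N = delta α rel N :=
        delta_congr fun E e he => hag E e (he.trans h.strong.1)
      have e3 := delta_submodular (fun E => (hα E).1.le) rel' X Y
      have e4 := h'.strong.2 (X ∩ Y) (Finset.subset_inter hNX hNY)
        (Finset.inter_subset_right.trans hY)
      refine ⟨rel', B', X ∪ Y, h', ?_, Finset.union_subset (hXB.trans hBB') hY,
        hNX.trans Finset.subset_union_left, ?_, ?_⟩
      · rw [Finset.card_insert_of_notMem hbS, Nat.succ_mul]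
        omega
      · exact Finset.insert_subset (Finset.mem_union_right _ hbY)
          (hSX.trans Finset.subset_union_left)
      · rw [Finset.card_insert_of_notMem hbS]
        push_cast
        linarith
  obtain ⟨rel, B, C, h, hc, hCB, hNC, hSC, hδ⟩ := key (B₀ \ N) Finset.sdiff_subset
  refine ⟨rel, C, ?_, fun E e he => (h.supported E e he).2, h.agree,
    fun X hX => h.inK X (hX.trans hCB), ⟨hNC, fun X hNX hX => h.strong.2 X hNX (hX.trans hCB)⟩,
    ?_, ?_, fun X hX => h.le X (hX.trans hCB)⟩
  · rw [← Finset.sdiff_union_of_subset hN.1]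
    exact Finset.union_subset hSC hNC
  · exact (Finset.card_le_card hCB).trans (hc.trans (by gcongr))
  · have hp' : ((B₀ \ N).card : ℝ) ≤ p := by exact_mod_cast hp
    have : ((B₀ \ N).card : ℝ) * (η / (p + 1)) < η := by
      rw [← mul_div_assoc, div_lt_iff₀ (by positivity)]
      nlinarith
    linarith

end SmallExtension

section Charts

variable {L V W : Type} {rel : L → Finset V → Prop} {rel' : L → Finset W → Prop}

/-- `f` embeds the hypergraph `rel` on `N` into the hypergraph `rel'`. -/
structure IsChart [DecidableEq W] (rel : L → Finset V → Prop) (rel' : L → Finset W → Prop)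
    (N : Finset V) (f : V → W) : Prop where
  injOn : Set.InjOn f N
  iff : ∀ E, ∀ e ⊆ N, (rel E e ↔ rel' E (e.image f))

theorem IsChart.mono [DecidableEq W] {N M : Finset V} {f : V → W} (h : IsChart rel rel' N f)
    (hM : M ⊆ N) : IsChart rel rel' M f :=
  ⟨h.injOn.mono (by exact_mod_cast hM), fun E e he => h.iff E e (he.trans hM)⟩

theorem IsChart.card_image [DecidableEq W] {N X : Finset V} {f : V → W}
    (h : IsChart rel rel' N f) (hX : X ⊆ N) : (X.image f).card = X.card :=
  Finset.card_image_of_injOn (h.mono hX).injOn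

variable [Fintype L] {α : L → ℝ}

theorem IsChart.delta_image [DecidableEq W] {N X : Finset V} {f : V → W}
    (h : IsChart rel rel' N f) (hX : X ⊆ N) : delta α rel' (X.image f) = delta α rel X :=
  _root_.delta_image (h.mono hX).injOn (h.mono hX).iff

/-- Adding at most `t` points to `A` does not lower the rank. -/
def tStrong (α : L → ℝ) (rel : L → Finset V → Prop) (t : ℕ) (A : Finset V) : Prop :=
  ∀ X, A ⊆ X → X.card ≤ A.card + t → delta α rel A ≤ delta α rel X

theorem tStrong.mono {t t' : ℕ} {A : Finset V} (h : tStrong α rel t A) (ht : t' ≤ t) :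
    tStrong α rel t' A := fun X hAX hX => h X hAX (hX.trans (by omega))

theorem tStrong.of_delta_eq_zero (hK : ∀ X, 0 ≤ delta α rel X) {A : Finset V}
    (hA : delta α rel A = 0) (t : ℕ) : tStrong α rel t A := fun X _ _ => hA ▸ hK X

theorem exists_tStrong_superset_card_le (hα : ∀ E, 0 < α E) (t q : ℕ) :
    ∃ S : ℕ, ∀ {V : Type} {rel : L → Finset V → Prop}, (∀ X, 0 ≤ delta α rel X) →
      ∀ A : Finset V, A.card ≤ q → ∃ C, A ⊆ C ∧ tStrong α rel t C ∧ C.card ≤ S := by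
  obtain ⟨η, hη, hgap⟩ := exists_delta_gap hα t
  have key : ∀ m : ℕ, ∀ {V : Type} {rel : L → Finset V → Prop}, (∀ X, 0 ≤ delta α rel X) →
      ∀ A : Finset V, delta α rel A < m * η →
        ∃ C, A ⊆ C ∧ tStrong α rel t C ∧ C.card ≤ A.card + m * t := by
    intro m
    induction m with
    | zero =>
      intro V rel hK A hA
      have := hK A
      simp at hA
      linarith
    | succ m ih =>
      intro V rel hK A hA
      by_cases hs : tStrong α rel t A
      · exact ⟨A, subset_rfl, hs, by omega⟩
      · unfold tStrong at hs
        push Not at hs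
        obtain ⟨X, hAX, hX, hlt⟩ := hs
        have := hgap V rel A X hAX hX hlt
        obtain ⟨C, hXC, hC, hCc⟩ := ih hK X (by push_cast at hA; linarith)
        exact ⟨C, hAX.trans hXC, hC, by rw [Nat.succ_mul]; omega⟩
  obtain ⟨m, hm⟩ := exists_nat_gt ((q : ℝ) / η)
  rw [div_lt_iff₀ hη] at hm
  refine ⟨q + m * t, fun {V rel} hK A hA => ?_⟩
  have hA' : (A.card : ℝ) ≤ q := by exact_mod_cast hA
  obtain ⟨C, hAC, hC, hCc⟩ := key m hK A
    (by linarith [delta_le_card (fun E => (hα E).le) rel A])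
  exact ⟨C, hAC, hC, by omega⟩

theorem exists_injOn_extension [DecidableEq V] [Infinite V] [DecidableEq W] {N : Finset V}
    {f : V → W} (hf : Set.InjOn f N) (R : Finset W) :
    ∃ (M : Finset V) (g : V → W), N ⊆ M ∧ (∀ x ∈ N, g x = f x) ∧ Set.InjOn g M ∧
      M.image g = N.image f ∪ R := by
  induction R using Finset.induction_on with
  | empty => exact ⟨N, f, subset_rfl, fun _ _ => rfl, hf, by simp⟩
  | insert r R _ ih =>
    obtain ⟨M, g, hNM, hgf, hg, him⟩ := ih
    by_cases hr : r ∈ N.image f ∪ R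
    · refine ⟨M, g, hNM, hgf, hg, ?_⟩
      rw [Finset.union_insert, Finset.insert_eq_of_mem hr, him]
    · obtain ⟨x, hx⟩ := Infinite.exists_notMem_finset M
      have hup : ∀ y ∈ M, Function.update g x r y = g y := fun y hy =>
        Function.update_of_ne (ne_of_mem_of_not_mem hy hx) _ _
      have himg : M.image (Function.update g x r) = M.image g :=
        Finset.image_congr fun y hy => hup y hy
      refine ⟨insert x M, Function.update g x r, hNM.trans (Finset.subset_insert _ _), ?_, ?_, ?_⟩
      · exact fun y hy => (hup y (hNM hy)).trans (hgf y hy)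
      · rw [Finset.coe_insert, Set.injOn_insert (by exact_mod_cast hx)]
        refine ⟨fun y hy z hz hyz => hg hy hz ?_, ?_⟩
        · rwa [hup y hy, hup z hz] at hyz
        · rw [Function.update_self]
          rintro ⟨y, hy, hyr⟩
          rw [hup y hy] at hyr
          rw [← him] at hr
          exact hr (Finset.mem_image.2 ⟨y, hy, hyr⟩)
      · rw [Finset.image_insert, Function.update_self, himg, him, Finset.union_insert]

/-- Copies of a `k`-strong set in a nearly closed extension remain `k`-strong. -/
theorem IsChart.tStrong_image [DecidableEq V] [DecidableEq W] (hα : ∀ E, 0 ≤ α E) {k t : ℕ}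
    {η : ℝ}
    (hgap : ∀ C X : Finset W, C ⊆ X → X.card ≤ C.card + k →
      delta α rel' X < delta α rel' C → delta α rel' X + η ≤ delta α rel' C)
    {N M B G : Finset V} {g : V → W} (hg : IsChart rel rel' G g) (hNB : N ⊆ B) (hBG : B ⊆ G)
    (hMB : M ⊆ B)
    (hle : ∀ X ⊆ G, (X \ B).card ≤ k → delta α rel (X ∩ B) ≤ delta α rel X)
    (hM : ∀ Y ⊆ B, M ⊆ Y → Y.card ≤ M.card + k → delta α rel M ≤ delta α rel Y)
    (hδ : delta α rel G < delta α rel N + η) (hN : tStrong α rel' t (N.image g))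
    (ht : k + (G \ N).card ≤ t) : tStrong α rel' k (M.image g) := by
  intro X hMX hXk
  by_contra hlt
  have h1 := hgap _ X hMX hXk (not_le.1 hlt)
  have h2 := delta_submodular hα rel' X (G.image g)
  have hMG := hMB.trans hBG
  obtain ⟨Y, hY, hYX⟩ := Finset.subset_image_iff.1
    (Finset.inter_subset_right : X ∩ G.image g ⊆ G.image g)
  have hYG : Y ⊆ G := by exact_mod_cast hY
  have hMY : M ⊆ Y := by
    intro z hz
    have hz' : g z ∈ Y.image g := by
      rw [hYX]
      exact Finset.mem_inter.2 ⟨hMX (Finset.mem_image_of_mem g hz),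
        Finset.mem_image_of_mem g (hMG hz)⟩
    obtain ⟨y, hy, hyz⟩ := Finset.mem_image.1 hz'
    rwa [← hg.injOn (hYG hy) (hMG hz) hyz]
  have hYc : Y.card ≤ M.card + k := by
    rw [← hg.card_image hYG, ← hg.card_image hMG, hYX]
    exact (Finset.card_le_card Finset.inter_subset_left).trans hXk
  have h3 : delta α rel M ≤ delta α rel Y := by
    have hMYB : M ⊆ Y ∩ B := Finset.subset_inter hMY hMB
    refine (hM (Y ∩ B) Finset.inter_subset_right hMYB
      ((Finset.card_le_card Finset.inter_subset_left).trans hYc)).trans (hle Y hYG ?_)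
    have := Finset.card_le_card (Finset.sdiff_subset_sdiff (subset_refl Y) hMB)
    rw [Finset.card_sdiff_of_subset hMY] at this
    omega
  have hNG := hNB.trans hBG
  have h4 : delta α rel' (N.image g) ≤ delta α rel' (X ∪ G.image g) := by
    apply hN _ ((Finset.image_subset_image hNG).trans Finset.subset_union_right)
    have e1 := Finset.card_sdiff_add_card_eq_card hNG
    have e2 := hg.card_image (subset_refl G)
    have e3 := hg.card_image hNG
    have e4 := hg.card_image hMG
    have e5 : (X ∪ G.image g).card ≤ (G.image g).card + (X \ M.image g).card := by
      rw [Finset.union_comm, ← Finset.union_sdiff_self_eq_union]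
      refine (Finset.card_union_le _ _).trans (Nat.add_le_add_left (Finset.card_le_card ?_) _)
      exact Finset.sdiff_subset_sdiff subset_rfl (Finset.image_subset_image hMG)
    have e6 := Finset.card_sdiff_of_subset hMX
    omega
  rw [hg.delta_image hMG] at h1
  rw [← hYX, hg.delta_image hYG, hg.delta_image (subset_refl G)] at h2
  rw [hg.delta_image hNG] at h4
  linarith

end Charts

section Structures

variable {L V : Type} {ar : L → ℕ} [DecidableEq V] [(hypLang L ar).Structure V]

theorem relOf_card {E : L} {e : Finset V} (h : relOf L ar V E e) : e.card = ar E := by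
  obtain ⟨x, hx, rfl, -⟩ := h
  rw [Finset.card_image_of_injective _ hx, Finset.card_univ, Fintype.card_fin]

theorem relMap_iff_relOf (hV : properStructure L ar V) (E : L) (y : Fin (ar E) → V) :
    @Structure.RelMap (hypLang L ar) V _ (ar E) ⟨E, rfl⟩ y ↔
      Function.Injective y ∧ relOf L ar V E (Finset.univ.image y) := by
  constructor
  · intro h
    have hy := (hV _ _ y).1 h
    exact ⟨hy, y, hy, rfl, h⟩
  · rintro ⟨hy, x, hx, hxy, h⟩
    have hex : ∀ i, ∃ j, x j = y i := by
      intro i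
      have : y i ∈ Finset.univ.image x := hxy ▸ Finset.mem_image_of_mem _ (Finset.mem_univ i)
      simpa using this
    choose σ hσ using hex
    have hσi : Function.Injective σ := fun i j hij => hy (by rw [← hσ, ← hσ, hij])
    have := (hV _ _ x).2 (Equiv.ofBijective σ (Finite.injective_iff_bijective.1 hσi)) h
    convert this using 1
    funext i
    exact (hσ i).symm

/-- A hypergraph on `ℕ` isomorphic to a given finite set. -/
def pullback {L V : Type} (ar : L → ℕ) [DecidableEq V] [(hypLang L ar).Structure V]
    (M : Finset ℕ) (f : ℕ → V) : L → Finset ℕ → Prop :=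
  fun E e => e ⊆ M ∧ relOf L ar V E (e.image f)

theorem isChart_pullback {M : Finset ℕ} {f : ℕ → V} (hf : Set.InjOn f M) :
    IsChart (pullback ar M f) (relOf L ar V) M f :=
  ⟨hf, fun _ _ he => ⟨fun h => h.2, fun h => ⟨he, h⟩⟩⟩

theorem supportedOn_pullback {M : Finset ℕ} {f : ℕ → V} (hf : Set.InjOn f M) :
    supportedOn ar (pullback ar M f) M := by
  rintro E e ⟨he, h⟩
  rw [← relOf_card h, Finset.card_image_of_injOn (hf.mono (by exact_mod_cast he))]
  exact ⟨he, rfl⟩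

variable [Fintype L] {α : L → ℝ}

theorem modelsSalpha.nonneg (h : modelsSalpha L ar α V) (X : Finset V) :
    0 ≤ delta α (relOf L ar V) X := h.2.1 X X subset_rfl

theorem IsChart.inK {rel : L → Finset ℕ → Prop} {M : Finset ℕ} {f : ℕ → V}
    (hf : IsChart rel (relOf L ar V) M f) (h : modelsSalpha L ar α V) : inK α rel M := by
  intro X hX
  rw [← hf.delta_image hX]
  exact h.nonneg _

theorem modelsSalpha.exists_isChart (h : modelsSalpha L ar α V) {rel : L → Finset ℕ → Prop}
    (hrel : ∀ E e, rel E e → e.card = ar E) {A B : Finset ℕ} (hB : inK α rel B)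
    (hAB : strong α rel A B) {f : ℕ → V} (hf : IsChart rel (relOf L ar V) A f) :
    ∃ g : ℕ → V, (∀ a ∈ A, g a = f a) ∧ IsChart rel (relOf L ar V) B g := by
  obtain ⟨g, h1, h2, h3⟩ := h.2.2 rel hrel A B hAB.1 hB hAB f hf.injOn hf.iff
  exact ⟨g, h2, h1, h3⟩

end Structures

section BackAndForth

variable {L : Type} [Fintype L] {α : L → ℝ} {ar : L → ℕ}

/-- Given charts of the same hypergraph onto sufficiently strong sets of two models, every point of
the first model is matched by a point of the second. -/
theorem exists_matching_point [Nonempty L] (hr : ∀ E, 2 ≤ ar E) (hα : ∀ E, 0 < α E ∧ α E ≤ 1)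
    (k q : ℕ) :
    ∃ t : ℕ, ∀ {V W : Type} [DecidableEq V] [DecidableEq W] [(hypLang L ar).Structure V]
      [(hypLang L ar).Structure W], modelsSalpha L ar α V → modelsSalpha L ar α W →
      ∀ {rel : L → Finset ℕ → Prop} {N : Finset ℕ} {f : ℕ → V} {g : ℕ → W},
      IsChart rel (relOf L ar V) N f → IsChart rel (relOf L ar W) N g →
      tStrong α (relOf L ar V) t (N.image f) → tStrong α (relOf L ar W) t (N.image g) →
      ∀ P ⊆ N, P.card ≤ q → ∀ c : V,
        ∃ (rel' : L → Finset ℕ → Prop) (M : Finset ℕ) (f' : ℕ → V) (g' : ℕ → W) (x : ℕ),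
          IsChart rel' (relOf L ar V) M f' ∧ IsChart rel' (relOf L ar W) M g' ∧
          tStrong α (relOf L ar V) k (M.image f') ∧ tStrong α (relOf L ar W) k (M.image g') ∧
          P ⊆ M ∧ x ∈ M ∧ (∀ a ∈ P, f' a = f a) ∧ (∀ a ∈ P, g' a = g a) ∧ f' x = c := by
  have hα0 : ∀ E, 0 ≤ α E := fun E => (hα E).1.le
  obtain ⟨η, hη, hgap⟩ := exists_delta_gap (fun E => (hα E).1) k
  obtain ⟨S, hS⟩ := exists_tStrong_superset_card_le (fun E => (hα E).1) k (q + 1)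
  obtain ⟨T, hT⟩ := exists_near_extension hr hα k S hη
  refine ⟨k + S + T, fun {V W} _ _ _ _ hV hW {rel N f g} hf hg hfN hgN P hPN hPq c => ?_⟩
  obtain ⟨C, hPC, hC, hCS⟩ := hS hV.nonneg (insert c (P.image f))
    ((Finset.card_insert_le _ _).trans (Nat.add_le_add_right (Finset.card_image_le.trans hPq) 1))
  obtain ⟨B, f', hNB, hff', hf'B, hBim⟩ := exists_injOn_extension hf.injOn C
  have hchart : IsChart (pullback ar B f') (relOf L ar V) B f' := isChart_pullback hf'B
  have hNim : N.image f' = N.image f := Finset.image_congr hff'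
  have hBN : (B \ N).card ≤ S := by
    have e1 := Finset.card_sdiff_add_card_eq_card hNB
    have e2 := hchart.card_image (subset_refl B)
    have e3 := hf.card_image (subset_refl N)
    have e4 := Finset.card_union_le (N.image f) C
    rw [← hBim] at e4
    omega
  have hstrong : strong α (pullback ar B f') N B := by
    refine ⟨hNB, fun X hNX hXB => ?_⟩
    rw [← hchart.delta_image hNB, ← hchart.delta_image hXB, hNim]
    apply hfN _ (hNim ▸ Finset.image_subset_image hNX)
    rw [hchart.card_image hXB, hf.card_image (subset_refl N)]
    have e1 := Finset.card_sdiff_add_card_eq_card hNB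
    have e2 := Finset.card_le_card hXB
    omega
  obtain ⟨rel', G, hBG, hcard, hagree, hK, hNG, hGc, hδ, hle⟩ :=
    hT (supportedOn_pullback hf'B) (hchart.inK hV) hstrong hBN
  have hgN' : IsChart rel' (relOf L ar W) N g := by
    refine ⟨hg.injOn, fun E e he => ?_⟩
    rw [hagree E e (he.trans hNB), hchart.iff E e (he.trans hNB), ← hg.iff E e he, hf.iff E e he]
    rw [Finset.image_congr fun z hz => hff' z (he hz)]
  obtain ⟨g', hgg', hg'⟩ := hW.exists_isChart hcard hK hNG hgN'
  have hf'chart : IsChart rel' (relOf L ar V) B f' :=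
    ⟨hf'B, fun E e he => (hagree E e he).trans (hchart.iff E e he)⟩
  have hCB : C ⊆ B.image f' := hBim ▸ Finset.subset_union_right
  obtain ⟨M, hM, hMC⟩ := Finset.subset_image_iff.1 hCB
  have hMB : M ⊆ B := by exact_mod_cast hM
  have hmem : ∀ z ∈ B, f' z ∈ C → z ∈ M := by
    intro z hz hzC
    rw [← hMC] at hzC
    obtain ⟨y, hy, hyz⟩ := Finset.mem_image.1 hzC
    rwa [← hf'B (hMB hy) hz hyz]
  obtain ⟨x, hx, hxc⟩ : ∃ x ∈ M, f' x = c := by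
    rw [← Finset.mem_image, hMC]
    exact hPC (Finset.mem_insert_self _ _)
  refine ⟨rel', M, f', g', x, hf'chart.mono hMB, hg'.mono (hMB.trans hBG), hMC.symm ▸ hC, ?_, ?_,
    hx, fun a ha => hff' a (hPN ha), fun a ha => hgg' a (hPN ha), hxc⟩
  · refine hg'.tStrong_image hα0 (hgap W _) hNB hBG hMB hle ?_ hδ
      (by rwa [Finset.image_congr hgg']) ?_
    · intro Y hY hMY hYc
      rw [← hf'chart.delta_image hMB, ← hf'chart.delta_image hY]
      rw [hMC]
      apply hC _ (hMC ▸ Finset.image_subset_image hMY)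
      rw [hf'chart.card_image hY, ← hMC, hf'chart.card_image hMB]
      exact hYc
    · have e1 := Finset.card_sdiff_add_card_eq_card hNB
      have e2 := Finset.card_sdiff_add_card_eq_card (hNB.trans hBG)
      omega
  · intro a ha
    apply hmem a (hNB (hPN ha))
    rw [hff' a (hPN ha)]
    exact hPC (Finset.mem_insert_of_mem (Finset.mem_image_of_mem f ha))

/-- Formulas are preserved between tuples with the same chart, if the charts are sufficiently
strong. -/
theorem exists_realize_iff [Nonempty L] (hr : ∀ E, 2 ≤ ar E) (hα : ∀ E, 0 < α E ∧ α E ≤ 1)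
    {n j : ℕ} (φ : (hypLang L ar).BoundedFormula (Fin n) j) :
    ∃ t : ℕ, ∀ {V W : Type} [DecidableEq V] [DecidableEq W] [(hypLang L ar).Structure V]
      [(hypLang L ar).Structure W], modelsSalpha L ar α V → modelsSalpha L ar α W →
      ∀ {rel : L → Finset ℕ → Prop} {N : Finset ℕ} {f : ℕ → V} {g : ℕ → W},
      IsChart rel (relOf L ar V) N f → IsChart rel (relOf L ar W) N g →
      tStrong α (relOf L ar V) t (N.image f) → tStrong α (relOf L ar W) t (N.image g) →
      ∀ (v : Fin n → V) (xs : Fin j → V) (v' : Fin n → W) (xs' : Fin j → W) (p : Fin n ⊕ Fin j → ℕ),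
        (∀ i, p i ∈ N) → (∀ i, Sum.elim v xs i = f (p i)) → (∀ i, Sum.elim v' xs' i = g (p i)) →
        (φ.Realize v xs ↔ φ.Realize v' xs') := by
  induction φ with
  | falsum => exact ⟨0, fun {_ _} _ _ _ _ _ _ {_ _ _ _} _ _ _ _ _ _ _ _ _ _ _ _ => Iff.rfl⟩
  | equal s₁ s₂ =>
    refine ⟨0, fun {_ _} _ _ _ _ _ _ {_ _ _ _} hf hg _ _ v xs v' xs' p hp hv hv' => ?_⟩
    cases s₁ with
    | func f _ => exact f.elim
    | var i₁ =>
    cases s₂ with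
    | func f _ => exact f.elim
    | var i₂ =>
    simp only [BoundedFormula.Realize, Term.realize_var, hv, hv']
    rw [hf.injOn.eq_iff (hp _) (hp _), hg.injOn.eq_iff (hp _) (hp _)]
  | @rel j l R ts =>
    refine ⟨0, fun {V W} _ _ _ _ hV hW {rel N f g} hf hg _ _ v xs v' xs' p hp hv hv' => ?_⟩
    obtain ⟨E, rfl⟩ := R
    have hts : ∀ i, ∃ z, ts i = Term.var z := by
      intro i
      cases h : ts i with
      | func f _ => exact f.elim
      | var z => exact ⟨z, rfl⟩
    choose z hz using hts
    simp only [BoundedFormula.Realize, hz, Term.realize_var, hv, hv']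
    rw [relMap_iff_relOf hV.1, relMap_iff_relOf hW.1]
    have e1 : ∀ {X : Type} (h : ℕ → X), Set.InjOn h N →
        (Function.Injective (fun i => h (p (z i))) ↔ Function.Injective (fun i => p (z i))) := by
      intro X h hh
      constructor
      · exact fun hi a b hab => hi (congrArg h hab)
      · exact fun hi a b hab => hi (hh (hp _) (hp _) hab)
    have e2 : ∀ {X : Type} [DecidableEq X] (h : ℕ → X),
        Finset.univ.image (fun i => h (p (z i)))
          = (Finset.univ.image (fun i => p (z i))).image h := by
      intro X _ h
      rw [Finset.image_image]
      rfl
    have e3 : Finset.univ.image (fun i => p (z i)) ⊆ N := by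
      intro y hy
      obtain ⟨i, -, rfl⟩ := Finset.mem_image.1 hy
      exact hp _
    rw [e1 f hf.injOn, e1 g hg.injOn, e2 f, e2 g, ← hf.iff E _ e3, ← hg.iff E _ e3]
  | imp φ₁ φ₂ ih₁ ih₂ =>
    obtain ⟨t₁, h₁⟩ := ih₁
    obtain ⟨t₂, h₂⟩ := ih₂
    refine ⟨max t₁ t₂, fun {_ _} _ _ _ _ hV hW {_ _ _ _} hf hg hfN hgN v xs v' xs' p hp hv
      hv' => ?_⟩
    simp only [BoundedFormula.realize_imp]
    rw [h₁ hV hW hf hg (hfN.mono (le_max_left _ _)) (hgN.mono (le_max_left _ _)) v xs v' xs' p hp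
      hv hv', h₂ hV hW hf hg (hfN.mono (le_max_right _ _)) (hgN.mono (le_max_right _ _)) v xs v'
      xs' p hp hv hv']
  | @all j φ ih =>
    obtain ⟨k, ih⟩ := ih
    obtain ⟨t, ht⟩ := exists_matching_point hr hα k (n + j)
    have key : ∀ {V W : Type} [DecidableEq V] [DecidableEq W] [(hypLang L ar).Structure V]
      [(hypLang L ar).Structure W], modelsSalpha L ar α V → modelsSalpha L ar α W →
      ∀ {rel : L → Finset ℕ → Prop} {N : Finset ℕ} {f : ℕ → V} {g : ℕ → W},
      IsChart rel (relOf L ar V) N f → IsChart rel (relOf L ar W) N g →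
      tStrong α (relOf L ar V) t (N.image f) → tStrong α (relOf L ar W) t (N.image g) →
      ∀ (v : Fin n → V) (xs : Fin j → V) (v' : Fin n → W) (xs' : Fin j → W) (p : Fin n ⊕ Fin j → ℕ),
        (∀ i, p i ∈ N) → (∀ i, Sum.elim v xs i = f (p i)) → (∀ i, Sum.elim v' xs' i = g (p i)) →
        φ.all.Realize v' xs' → φ.all.Realize v xs := by
      intro V W _ _ _ _ hV hW rel N f g hf hg hfN hgN v xs v' xs' p hp hv hv' h
      simp only [BoundedFormula.realize_all] at h ⊢
      intro c
      obtain ⟨rel', M, f', g', x, hf', hg', hfM, hgM, hPM, hx, hff', hgg', rfl⟩ :=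
        ht hV hW hf hg hfN hgN (Finset.univ.image p)
          (fun y hy => by obtain ⟨i, -, rfl⟩ := Finset.mem_image.1 hy; exact hp i)
          (Finset.card_image_le.trans (by simp)) c
      have hpi : ∀ i, p i ∈ Finset.univ.image p := fun i =>
        Finset.mem_image_of_mem p (Finset.mem_univ i)
      refine (ih hV hW hf' hg' hfM hgM v (Fin.snoc xs (f' x)) v' (Fin.snoc xs' (g' x))
        (Sum.elim (fun i => p (Sum.inl i)) (Fin.snoc (fun i => p (Sum.inr i)) x)) ?_ ?_ ?_).2 (h _)
      · rintro (i | i)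
        · exact hPM (hpi _)
        · refine Fin.lastCases ?_ (fun i => ?_) i
          · simpa using hx
          · simpa using hPM (hpi _)
      · rintro (i | i)
        · simpa [hff' _ (hpi _)] using hv (Sum.inl i)
        · refine Fin.lastCases ?_ (fun i => ?_) i
          · simp
          · simpa [hff' _ (hpi _)] using hv (Sum.inr i)
      · rintro (i | i)
        · simpa [hgg' _ (hpi _)] using hv' (Sum.inl i)
        · refine Fin.lastCases ?_ (fun i => ?_) i
          · simp
          · simpa [hgg' _ (hpi _)] using hv' (Sum.inr i)
    refine ⟨t, fun {_ _} _ _ _ _ hV hW {_ _ _ _} hf hg hfN hgN v xs v' xs' p hp hv hv' => ⟨?_, ?_⟩⟩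
    · exact key hW hV hg hf hgN hfN v' xs' v xs p hp hv' hv
    · exact key hV hW hf hg hfN hgN v xs v' xs' p hp hv hv'

end BackAndForth

section GenericModel

/-- An extension problem: extend an embedding of `A` to an embedding of `B`. -/
structure ExtensionTask (L : Type) where
  rel : L → Finset ℕ → Prop
  A : Finset ℕ
  B : Finset ℕ

/-- The points of the model obtained from a base by freely solving all extension problems. -/
inductive FreePoint (L : Type) : Type
  | base : ℕ → FreePoint L
  | new : ExtensionTask L → (ℕ → FreePoint L) → ℕ → FreePoint L

namespace FreePoint

variable {L : Type}

/-- The stage at which a point is created. -/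
def stage : FreePoint L → ℕ
  | base _ => 0
  | new T f _ => 1 + T.A.sup fun a => stage (f a)

/-- The free solution of the extension problem `T` at `f`. -/
def extend (T : ExtensionTask L) (f : ℕ → FreePoint L) : ℕ → FreePoint L :=
  fun a => if a ∈ T.A then f a else new T f a

theorem stage_lt {T : ExtensionTask L} {f : ℕ → FreePoint L} {a : ℕ} (ha : a ∈ T.A) (x : ℕ) :
    stage (f a) < stage (new T f x) := by
  have : stage (f a) ≤ T.A.sup fun a => stage (f a) :=
    Finset.le_sup (f := fun a => stage (f a)) ha
  simp only [stage]
  omega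

theorem stage_extend_le (T : ExtensionTask L) (f : ℕ → FreePoint L) (a x : ℕ) :
    stage (extend T f a) ≤ stage (new T f x) := by
  unfold extend
  split_ifs with h
  · exact (stage_lt h x).le
  · exact le_rfl

theorem base_injective : Function.Injective (base : ℕ → FreePoint L) := fun _ _ h => base.inj h

theorem extend_injective {T : ExtensionTask L} {f : ℕ → FreePoint L} (hf : Set.InjOn f T.A) :
    Function.Injective (extend T f) := by
  intro a b hab
  unfold extend at hab
  split_ifs at hab with ha hb hb
  · exact hf ha hb hab
  · exact absurd (stage_lt (f := f) ha b) (by rw [hab]; exact lt_irrefl _)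
  · exact absurd (stage_lt (f := f) hb a) (by rw [← hab]; exact lt_irrefl _)
  · exact (new.inj hab).2.2

open Classical in
/-- The edges of the free model: those of the base and those required by extension problems. -/
def Edge [Fintype L] (α : L → ℝ) (ar : L → ℕ) (rel₀ : L → Finset ℕ → Prop) (E : L)
    (e : Finset (FreePoint L)) : Prop :=
  (∃ e₀, rel₀ E e₀ ∧ e = e₀.image base) ∨
  ∃ (T : ExtensionTask L) (f : ℕ → FreePoint L), (∀ E e, T.rel E e → e.card = ar E) ∧
    strong α T.rel T.A T.B ∧ Set.InjOn f T.A ∧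
    ∃ e' ⊆ T.B, ¬ e' ⊆ T.A ∧ T.rel E e' ∧ e = e'.image (extend T f)

variable [Fintype L] {α : L → ℝ} {ar : L → ℕ} {rel₀ : L → Finset ℕ → Prop}

theorem Edge.card_eq (h₀ : ∀ E e, rel₀ E e → e.card = ar E) {E : L} {e : Finset (FreePoint L)}
    (h : Edge α ar rel₀ E e) : e.card = ar E := by
  classical
  rcases h with ⟨e₀, h, rfl⟩ | ⟨T, f, hT, -, hf, e', -, -, he', rfl⟩
  · rw [Finset.card_image_of_injective _ base_injective, h₀ E _ h]
  · rw [Finset.card_image_of_injective _ (extend_injective hf), hT E _ he']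

open Classical in
theorem edge_of_mem_new {E : L} {e : Finset (FreePoint L)} (h : Edge α ar rel₀ E e)
    {T : ExtensionTask L} {f : ℕ → FreePoint L} {x : ℕ} (hx : new T f x ∈ e)
    (hmax : ∀ z ∈ e, stage z ≤ stage (new T f x)) :
    strong α T.rel T.A T.B ∧ Set.InjOn f T.A ∧
      ∃ e' ⊆ T.B, ¬ e' ⊆ T.A ∧ T.rel E e' ∧ e = e'.image (extend T f) := by
  rcases h with ⟨e₀, h, rfl⟩ | ⟨T', f', hT, hs, hf, e', heB, heA, he', rfl⟩
  · obtain ⟨z, -, hz⟩ := Finset.mem_image.1 hx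
    cases hz
  · obtain ⟨y, hy, hyA⟩ := Finset.not_subset.1 heA
    have h1 := hmax _ (Finset.mem_image_of_mem (extend T' f') hy)
    rw [show extend T' f' y = new T' f' y from if_neg hyA] at h1
    obtain ⟨z, hz, hzx⟩ := Finset.mem_image.1 hx
    by_cases hzA : z ∈ T'.A
    · rw [show extend T' f' z = f' z from if_pos hzA] at hzx
      have := stage_lt (f := f') hzA y
      rw [hzx] at this
      omega
    · rw [show extend T' f' z = new T' f' z from if_neg hzA] at hzx
      obtain ⟨rfl, rfl, -⟩ := new.inj hzx
      exact ⟨hs, hf, e', heB, heA, he', rfl⟩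

open Classical in
theorem isChart_base : IsChart rel₀ (Edge α ar rel₀) N base := by
  refine ⟨base_injective.injOn, fun E e _ => ⟨fun h => Or.inl ⟨e, h, rfl⟩, ?_⟩⟩
  rintro (⟨e₀, h, he⟩ | ⟨T, f, -, -, hf, e', -, heA, -, he⟩)
  · rwa [Finset.image_injective base_injective he]
  · obtain ⟨y, hy, hyA⟩ := Finset.not_subset.1 heA
    have h1 := Finset.mem_image_of_mem (extend T f) hy
    rw [← he, show extend T f y = new T f y from if_neg hyA] at h1
    obtain ⟨z, -, hz⟩ := Finset.mem_image.1 h1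
    cases hz

open Classical in
theorem isChart_extend {T : ExtensionTask L} {f : ℕ → FreePoint L}
    (hT : ∀ E e, T.rel E e → e.card = ar E) (hs : strong α T.rel T.A T.B)
    (hf : IsChart T.rel (Edge α ar rel₀) T.A f) :
    IsChart T.rel (Edge α ar rel₀) T.B (extend T f) := by
  refine ⟨(extend_injective hf.injOn).injOn, fun E e he => ?_⟩
  by_cases heA : e ⊆ T.A
  · rw [hf.iff E e heA, Finset.image_congr (f := f) (g := extend T f)
      fun a ha => (if_pos (heA ha)).symm]
  · refine ⟨fun h => Or.inr ⟨T, f, hT, hs, hf.injOn, e, he, heA, h, rfl⟩, fun h => ?_⟩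
    obtain ⟨y, hy, hyA⟩ := Finset.not_subset.1 heA
    have h1 := Finset.mem_image_of_mem (extend T f) hy
    rw [show extend T f y = new T f y from if_neg hyA] at h1
    obtain ⟨-, -, e', -, -, he', hee'⟩ := edge_of_mem_new h h1 (by
      intro z hz
      obtain ⟨a, -, rfl⟩ := Finset.mem_image.1 hz
      exact stage_extend_le T f a y)
    rwa [Finset.image_injective (extend_injective hf.injOn) hee']

open Classical in
/-- Removing the points created last, by one extension problem, does not raise the rank. -/
theorem delta_filter_le (hα : ∀ E, 0 ≤ α E) {X : Finset (FreePoint L)} {T : ExtensionTask L}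
    {f : ℕ → FreePoint L} {x : ℕ} (hmax : ∀ z ∈ X, stage z ≤ stage (new T f x)) :
    delta α (Edge α ar rel₀) (X.filter fun z => ∀ y, z ≠ new T f y)
      ≤ delta α (Edge α ar rel₀) X := by
  set X₀ := X.filter fun z => ∀ y, z ≠ new T f y with hX₀
  by_cases hval : strong α T.rel T.A T.B ∧ Set.InjOn f T.A
  · obtain ⟨hs, hf⟩ := hval
    set Y := T.B.filter fun b => extend T f b ∈ X with hY
    have hYB : Y ⊆ T.B := Finset.filter_subset _ _
    have hcard : (Y.card : ℝ) - (Y ∩ T.A).card ≤ X.card - X₀.card := by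
      have h1 : (Y \ T.A).image (new T f) ⊆ X \ X₀ := by
        intro z hz
        obtain ⟨y, hy, rfl⟩ := Finset.mem_image.1 hz
        obtain ⟨hyY, hyA⟩ := Finset.mem_sdiff.1 hy
        have h2 := (Finset.mem_filter.1 hyY).2
        rw [show extend T f y = new T f y from if_neg hyA] at h2
        refine Finset.mem_sdiff.2 ⟨h2, fun h3 => ?_⟩
        exact (Finset.mem_filter.1 h3).2 y rfl
      have h2 := Finset.card_le_card h1
      rw [Finset.card_image_of_injective _ (fun a b hab => (new.inj hab).2.2)] at h2
      have h3 := Finset.card_sdiff_add_card_eq_card (Finset.filter_subset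
        (fun z => ∀ y, z ≠ new T f y) X)
      have h4 := Finset.card_sdiff_add_card_inter Y T.A
      rw [← hX₀] at h3
      have h5 : ((Y \ T.A).card : ℝ) ≤ (X \ X₀).card := by exact_mod_cast h2
      have h6 : ((X \ X₀).card : ℝ) + X₀.card = X.card := by exact_mod_cast h3
      have h7 : ((Y \ T.A).card : ℝ) + (Y ∩ T.A).card = Y.card := by exact_mod_cast h4
      linarith
    have hedge : ∀ E, (edgeCount (Edge α ar rel₀) E X : ℝ) - edgeCount (Edge α ar rel₀) E X₀
        ≤ edgeCount T.rel E Y - edgeCount T.rel E (Y ∩ T.A) := by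
      intro E
      have h1 : {e | e ⊆ X ∧ Edge α ar rel₀ E e} \ {e | e ⊆ X₀ ∧ Edge α ar rel₀ E e} ⊆
          (fun e : Finset ℕ => e.image (extend T f)) ''
            ({e | e ⊆ Y ∧ T.rel E e} \ {e | e ⊆ Y ∩ T.A ∧ T.rel E e}) := by
        rintro e ⟨⟨heX, he⟩, he₀⟩
        have : ¬ e ⊆ X₀ := fun h => he₀ ⟨h, he⟩
        obtain ⟨z, hz, hzX₀⟩ := Finset.not_subset.1 this
        have hz' : ∃ y, z = new T f y := by
          by_contra hne
          push Not at hne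
          exact hzX₀ (Finset.mem_filter.2 ⟨heX hz, hne⟩)
        obtain ⟨y, rfl⟩ := hz'
        obtain ⟨-, -, e', heB, heA, he', rfl⟩ :=
          edge_of_mem_new he hz fun w hw => hmax w (heX hw)
        refine ⟨e', ⟨⟨fun a ha => Finset.mem_filter.2
          ⟨heB ha, heX (Finset.mem_image_of_mem _ ha)⟩, he'⟩, fun h => ?_⟩, rfl⟩
        exact heA (h.1.trans Finset.inter_subset_right)
      have hfin := (edgeSet_finite T.rel E Y).sdiff (t := {e | e ⊆ Y ∩ T.A ∧ T.rel E e})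
      have h2 := (Set.ncard_le_ncard h1 (hfin.image _)).trans (Set.ncard_image_le hfin)
      have h3 := Set.ncard_sdiff_add_ncard_of_subset (s := {e | e ⊆ X₀ ∧ Edge α ar rel₀ E e})
        (t := {e | e ⊆ X ∧ Edge α ar rel₀ E e})
        (fun e he => ⟨he.1.trans (Finset.filter_subset _ _), he.2⟩) (edgeSet_finite _ E X)
      have h4 := Set.ncard_sdiff_add_ncard_of_subset (s := {e | e ⊆ Y ∩ T.A ∧ T.rel E e})
        (t := {e | e ⊆ Y ∧ T.rel E e})
        (fun e he => ⟨he.1.trans Finset.inter_subset_left, he.2⟩) (edgeSet_finite _ E Y)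
      have h5 : edgeCount (Edge α ar rel₀) E X + edgeCount T.rel E (Y ∩ T.A)
          ≤ edgeCount T.rel E Y + edgeCount (Edge α ar rel₀) E X₀ := by
        unfold edgeCount
        omega
      have h6 : (edgeCount (Edge α ar rel₀) E X : ℝ) + edgeCount T.rel E (Y ∩ T.A)
          ≤ edgeCount T.rel E Y + edgeCount (Edge α ar rel₀) E X₀ := by exact_mod_cast h5
      linarith
    have h1 := delta_submodular hα T.rel Y T.A
    have h2 := hs.2 (Y ∪ T.A) Finset.subset_union_right (Finset.union_subset hYB hs.1)
    have h3 : ∑ E, α E * ((edgeCount (Edge α ar rel₀) E X : ℝ) -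
        edgeCount (Edge α ar rel₀) E X₀)
        ≤ ∑ E, α E * ((edgeCount T.rel E Y : ℝ) - edgeCount T.rel E (Y ∩ T.A)) :=
      Finset.sum_le_sum fun E _ => mul_le_mul_of_nonneg_left (hedge E) (hα E)
    simp only [mul_sub, Finset.sum_sub_distrib] at h3
    unfold delta at h1 h2 ⊢
    linarith
  · unfold delta
    have hcard : (X₀.card : ℝ) ≤ X.card := by exact_mod_cast Finset.card_filter_le _ _
    have hedge : ∀ E, edgeCount (Edge α ar rel₀) E X = edgeCount (Edge α ar rel₀) E X₀ := by
      intro E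
      unfold edgeCount
      congr 1
      ext e
      simp only [Set.mem_ofPred_eq]
      refine ⟨fun he => ⟨fun z hz => Finset.mem_filter.2 ⟨he.1 hz, ?_⟩, he.2⟩,
        fun he => ⟨he.1.trans (Finset.filter_subset _ _), he.2⟩⟩
      rintro y rfl
      obtain ⟨h1, h2, -⟩ := edge_of_mem_new he.2 hz fun w hw => hmax w (he.1 hw)
      exact hval ⟨h1, h2⟩
    simp only [hedge]
    linarith

open Classical in
theorem exists_delta_base_le (hα : ∀ E, 0 ≤ α E) (X : Finset (FreePoint L)) :
    ∃ Z : Finset ℕ, (∀ z, z ∈ Z ↔ base z ∈ X) ∧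
      delta α rel₀ Z ≤ delta α (Edge α ar rel₀) X := by
  induction hn : X.card using Nat.strong_induction_on generalizing X with
  | _ n ih =>
  by_cases hnew : ∃ T f x, new T f x ∈ X
  · have hne : (X.filter fun z => ∃ T f x, z = new T f x).Nonempty := by
      obtain ⟨T, f, x, h⟩ := hnew
      exact ⟨_, Finset.mem_filter.2 ⟨h, T, f, x, rfl⟩⟩
    obtain ⟨z, hz, hmax⟩ := Finset.exists_max_image _ stage hne
    obtain ⟨hzX, T, f, x, rfl⟩ := Finset.mem_filter.1 hz
    have hmax' : ∀ w ∈ X, stage w ≤ stage (new T f x) := by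
      intro w hw
      cases w with
      | base y => simp [stage]
      | new T' f' y => exact hmax _ (Finset.mem_filter.2 ⟨hw, T', f', y, rfl⟩)
    have hlt : (X.filter fun z => ∀ y, z ≠ new T f y).card < n := by
      rw [← hn]
      refine Finset.card_lt_card ((Finset.filter_ssubset).2 ⟨_, hzX, fun h => h x rfl⟩)
    obtain ⟨Z, hZ, hδ⟩ := ih _ hlt _ rfl
    refine ⟨Z, fun y => ?_, hδ.trans (delta_filter_le hα hmax')⟩
    rw [hZ, Finset.mem_filter]
    exact ⟨fun h => h.1, fun h => ⟨h, fun _ h' => by cases h'⟩⟩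
  · push Not at hnew
    have him : X = (X.preimage base base_injective.injOn).image base := by
      ext w
      simp only [Finset.mem_image, Finset.mem_preimage]
      refine ⟨fun hw => ?_, ?_⟩
      · cases w with
        | base y => exact ⟨y, hw, rfl⟩
        | new T f y => exact absurd hw (hnew T f y)
      · rintro ⟨y, hy, rfl⟩
        exact hy
    refine ⟨X.preimage base base_injective.injOn, fun z => by simp, ?_⟩
    conv_rhs => rw [him]
    exact (isChart_base.delta_image (subset_refl _)).ge

end FreePoint

open FreePoint in
/-- Every finite hypergraph in the class is a strong substructure of some model. -/
theorem exists_model_strong {L : Type} [Fintype L] {α : L → ℝ} {ar : L → ℕ} (hα : ∀ E, 0 ≤ α E)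
    {rel₀ : L → Finset ℕ → Prop} {B : Finset ℕ} (hsup : supportedOn ar rel₀ B)
    (hK : inK α rel₀ B) :
    ∃ (W : Type) (_ : DecidableEq W) (_ : (hypLang L ar).Structure W) (f : ℕ → W),
      modelsSalpha L ar α W ∧ IsChart rel₀ (relOf L ar W) B f ∧
      ∀ X, B.image f ⊆ X → delta α (relOf L ar W) (B.image f) ≤ delta α (relOf L ar W) X := by
  classical
  let inst : (hypLang L ar).Structure (FreePoint L) :=
    { funMap := fun F _ => F.elim
      RelMap := fun {n} R x => Function.Injective x ∧
        Edge α ar rel₀ R.1 (Finset.univ.image x) }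
  have hcard : ∀ E e, rel₀ E e → e.card = ar E := fun E e h => (hsup E e h).2
  have hrel : relOf L ar (FreePoint L) = Edge α ar rel₀ := by
    funext E e
    apply propext
    constructor
    · rintro ⟨x, -, rfl, h⟩
      exact h.2
    · intro h
      have hc := h.card_eq hcard
      refine ⟨fun i => (e.equivFinOfCardEq hc).symm i, ?_, ?_, ?_⟩
      · exact Subtype.val_injective.comp (Equiv.injective _)
      · ext z
        simp only [Finset.mem_image, Finset.mem_univ, true_and]
        refine ⟨?_, fun hz => ⟨e.equivFinOfCardEq hc ⟨z, hz⟩, by simp⟩⟩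
        rintro ⟨i, rfl⟩
        exact Subtype.property _
      · refine ⟨Subtype.val_injective.comp (Equiv.injective _), ?_⟩
        convert h
        ext z
        simp only [Finset.mem_image, Finset.mem_univ, true_and]
        refine ⟨?_, fun hz => ⟨e.equivFinOfCardEq hc ⟨z, hz⟩, by simp⟩⟩
        rintro ⟨i, rfl⟩
        exact Subtype.property _
  have hB : ∀ Z, delta α rel₀ Z = delta α rel₀ (Z ∩ B) + ((Z \ B).card : ℝ) := by
    intro Z
    rw [delta_eq_add_card_sdiff (Finset.inter_subset_left : Z ∩ B ⊆ Z),
      Finset.sdiff_inter_self_left]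
    exact fun E e he h => Finset.subset_inter he (hsup E e h).1
  refine ⟨FreePoint L, inferInstance, inst, base, ⟨?_, ?_, ?_⟩, ?_, ?_⟩
  · intro n R x
    refine ⟨fun h => h.1, fun σ h => ⟨h.1.comp σ.injective, ?_⟩⟩
    have : Finset.univ.image (x ∘ σ) = Finset.univ.image x := by
      rw [← Finset.image_image, Finset.image_univ_equiv]
    rw [this]
    exact h.2
  · intro A X _
    rw [hrel]
    obtain ⟨Z, -, hZ⟩ := exists_delta_base_le (ar := ar) (rel₀ := rel₀) hα X
    refine le_trans ?_ hZ
    rw [hB]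
    exact add_nonneg (hK _ Finset.inter_subset_right) (Nat.cast_nonneg _)
  · intro rel' hrel' A C hAC _ hs f hf hiff
    rw [hrel] at hiff ⊢
    have := isChart_extend (T := ⟨rel', A, C⟩) (rel₀ := rel₀) hrel' hs ⟨hf, hiff⟩
    exact ⟨_, this.injOn, fun a ha => if_pos ha, this.iff⟩
  · rw [hrel]
    exact isChart_base
  · intro X hX
    rw [hrel]
    obtain ⟨Z, hmem, hZ⟩ := exists_delta_base_le (ar := ar) (rel₀ := rel₀) hα X
    rw [isChart_base.delta_image (subset_refl _)]
    refine le_trans ?_ hZ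
    rw [hB Z, Finset.inter_eq_right.2 fun b hb => (hmem b).2 (hX (Finset.mem_image_of_mem _ hb))]
    linarith [Nat.cast_nonneg (α := ℝ) (Z \ B).card]

end GenericModel

section Atomic

variable {L : Type} {ar : L → ℕ}

theorem isChart_of_relMap_iff {W : Type} [DecidableEq W] [(hypLang L ar).Structure W]
    (hW : properStructure L ar W) {rel : L → Finset ℕ → Prop}
    (hrel : ∀ E e, rel E e → e.card = ar E) {G : Finset ℕ} {g : ℕ → W} (hg : Set.InjOn g G)
    (h : ∀ E (y : Fin (ar E) → G), (Function.Injective y ∧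
      rel E (univ.image fun i => (y i : ℕ))) ↔
        @Structure.RelMap (hypLang L ar) W _ (ar E) ⟨E, rfl⟩ fun i => g (y i)) :
    IsChart rel (relOf L ar W) G g := by
  refine ⟨hg, fun E e he => ?_⟩
  by_cases hc : e.card = ar E
  · let y : Fin (ar E) → G := fun i =>
      ⟨(e.equivFinOfCardEq hc).symm i, he (Subtype.property _)⟩
    have hy : Function.Injective y := fun i j hij => by
      have := congrArg Subtype.val hij
      exact (e.equivFinOfCardEq hc).symm.injective (Subtype.ext this)
    have him : (univ.image fun i => (y i : ℕ)) = e := by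
      ext z
      simp only [Finset.mem_image, Finset.mem_univ, true_and]
      refine ⟨?_, fun hz => ⟨e.equivFinOfCardEq hc ⟨z, hz⟩, by simp [y]⟩⟩
      rintro ⟨i, rfl⟩
      exact ((e.equivFinOfCardEq hc).symm i).2
    have him' : (univ.image fun i => g (y i)) = e.image g := by
      conv_rhs => rw [← him]
      rw [Finset.image_image]
      rfl
    have hgy : Function.Injective fun i => g (y i) := fun i j hij =>
      hy (Subtype.ext (hg (y i).2 (y j).2 hij))
    have := h E y
    rw [relMap_iff_relOf hW, him, him'] at this
    simpa only [hy, hgy, true_and] using this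
  · refine iff_of_false (fun h => hc (hrel E e h)) fun h => hc ?_
    rw [← Finset.card_image_of_injOn (hg.mono (Finset.coe_subset.2 he))]
    exact relOf_card h

theorem IsChart.relMap_iff {W : Type} [DecidableEq W] [(hypLang L ar).Structure W]
    (hW : properStructure L ar W) {rel : L → Finset ℕ → Prop} {G : Finset ℕ} {g : ℕ → W}
    (hg : IsChart rel (relOf L ar W) G g) (E : L) (y : Fin (ar E) → G) :
    (Function.Injective y ∧ rel E (univ.image fun i => (y i : ℕ))) ↔
      @Structure.RelMap (hypLang L ar) W _ (ar E) ⟨E, rfl⟩ fun i => g (y i) := by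
  have hsub : (univ.image fun i => (y i : ℕ)) ⊆ G := by
    intro z hz
    obtain ⟨i, -, rfl⟩ := Finset.mem_image.1 hz
    exact (y i).2
  rw [relMap_iff_relOf hW, hg.iff E _ hsub, Finset.image_image]
  refine and_congr ⟨fun hy i j hij => hy (Subtype.ext (hg.injOn (y i).2 (y j).2 hij)),
    fun hy i j hij => hy ?_⟩ Iff.rfl
  simp only [hij]

open Classical in
/-- The formula stating that `χ` holds or fails according to `P`. -/
noncomputable def signedFormula {L' : Language} {β : Type} (P : Prop) (χ : L'.Formula β) :
    L'.Formula β :=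
  if P then χ else χ.not

theorem realize_signedFormula {L' : Language} {β M : Type} [L'.Structure M] {P : Prop}
    {χ : L'.Formula β} {v : β → M} : (signedFormula P χ).Realize v ↔ (P ↔ χ.Realize v) := by
  unfold signedFormula
  split_ifs with h <;> simp [h]

/-- The existential diagram of a finite hypergraph is a first-order formula. -/
theorem exists_diagram_formula [Finite L] {rel : L → Finset ℕ → Prop}
    (hrel : ∀ E e, rel E e → e.card = ar E) {G : Finset ℕ} (hG : G.Nonempty) {n : ℕ}
    {p : Fin n → ℕ} (hp : ∀ i, p i ∈ G) :
    ∃ ψ : (hypLang L ar).Formula (Fin n), ∀ {W : Type} [DecidableEq W]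
      [(hypLang L ar).Structure W], properStructure L ar W → ∀ b : Fin n → W,
        ψ.Realize b ↔ ∃ g : ℕ → W, IsChart rel (relOf L ar W) G g ∧ ∀ i, b i = g (p i) := by
  obtain ⟨x₀, hx₀⟩ := hG
  let ψ₁ : (hypLang L ar).Formula (Fin n ⊕ G) :=
    Formula.iInf fun i => (Term.var (Sum.inl i)).equal (Term.var (Sum.inr ⟨p i, hp i⟩))
  let ψ₂ : (hypLang L ar).Formula (Fin n ⊕ G) :=
    Formula.iInf fun x : G × G => signedFormula (x.1 = x.2)
      ((Term.var (Sum.inr x.1)).equal (Term.var (Sum.inr x.2)))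
  let ψ₃ : (hypLang L ar).Formula (Fin n ⊕ G) :=
    Formula.iInf fun y : Σ E, Fin (ar E) → G =>
      signedFormula (Function.Injective y.2 ∧ rel y.1 (univ.image fun i => (y.2 i : ℕ)))
        (Relations.formula (L := hypLang L ar) (n := ar y.1) ⟨y.1, rfl⟩
          fun i => Term.var (Sum.inr (y.2 i)))
  refine ⟨(ψ₁ ⊓ (ψ₂ ⊓ ψ₃)).iExs G, fun {W} _ _ hW b => ?_⟩
  have key : ∀ w : G → W, (ψ₁ ⊓ (ψ₂ ⊓ ψ₃)).Realize (Sum.elim b w) ↔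
      (∀ i, b i = w ⟨p i, hp i⟩) ∧ (∀ x y, x = y ↔ w x = w y) ∧
      ∀ E (y : Fin (ar E) → G), (Function.Injective y ∧
      rel E (univ.image fun i => (y i : ℕ))) ↔
        @Structure.RelMap (hypLang L ar) W _ (ar E) ⟨E, rfl⟩ fun i => w (y i) := by
    intro w
    simp only [ψ₁, ψ₂, ψ₃, Formula.realize_inf, Formula.realize_iInf, realize_signedFormula,
      Formula.realize_equal, Term.realize_var, Sum.elim_inl, Sum.elim_inr, Prod.forall,
      Sigma.forall]
    exact and_congr Iff.rfl (and_congr Iff.rfl (forall₂_congr fun E y =>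
      iff_congr Iff.rfl Formula.realize_rel))
  rw [Formula.realize_iExs]
  constructor
  · rintro ⟨w, hw⟩
    obtain ⟨h1, h2, h3⟩ := (key w).1 hw
    have hval : ∀ x : G, (fun z => if h : z ∈ G then w ⟨z, h⟩ else w ⟨x₀, hx₀⟩ : ℕ → W) x = w x :=
      fun x => dif_pos x.2
    refine ⟨fun z => if h : z ∈ G then w ⟨z, h⟩ else w ⟨x₀, hx₀⟩,
      isChart_of_relMap_iff hW hrel ?_ ?_, fun i => ?_⟩
    · intro x hx y hy hxy
      have := (hval ⟨x, hx⟩).symm.trans (hxy.trans (hval ⟨y, hy⟩))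
      exact congrArg Subtype.val ((h2 _ _).2 this)
    · intro E y
      rw [h3 E y]
      simp only [hval]
    · rw [h1 i]
      exact (hval ⟨p i, hp i⟩).symm
  · rintro ⟨g, hg, hb⟩
    refine ⟨fun x => g x, (key _).2 ⟨hb, fun x y => ⟨fun h => by rw [h], fun h => ?_⟩, fun E y =>
      hg.relMap_iff hW E y⟩⟩
    exact Subtype.ext (hg.injOn x.2 y.2 h)

theorem exists_injOn_image_eq {V : Type} [DecidableEq V] [Nonempty V] (B : Finset V) :
    ∃ (M : Finset ℕ) (f : ℕ → V), Set.InjOn f M ∧ M.image f = B := by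
  obtain ⟨M, g, -, -, hg, him⟩ := exists_injOn_extension (N := (∅ : Finset ℕ))
    (f := fun _ => Classical.arbitrary V) (by simp) B
  exact ⟨M, g, hg, by simpa using him⟩

theorem IsChart.empty {V : Type} [DecidableEq V] [(hypLang L ar).Structure V]
    (har : ∀ E, 2 ≤ ar E) {rel : L → Finset ℕ → Prop} (hrel : ∀ E e, rel E e → e.card = ar E)
    (f : ℕ → V) : IsChart rel (relOf L ar V) ∅ f := by
  refine ⟨by simp, fun E e he => ?_⟩
  obtain rfl := Finset.subset_empty.1 he
  have := har E
  refine iff_of_false (fun h => ?_) fun h => ?_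
  · have := hrel E _ h
    simp at this
    omega
  · have := relOf_card h
    simp at this
    omega

variable [Fintype L] {α : L → ℝ} {V : Type} [(hypLang L ar).Structure V]

/-- `φ` isolates the type of `a` among models. -/
def Isolates (α : L → ℝ) {n : ℕ} (φ : (hypLang L ar).Formula (Fin n)) (a : Fin n → V) : Prop :=
  φ.Realize a ∧ ∀ ψ : (hypLang L ar).Formula (Fin n), ψ.Realize a →
    ∀ (W : Type) [DecidableEq W] [(hypLang L ar).Structure W],
      modelsSalpha L ar α W → ∀ b : Fin n → W, φ.Realize b → ψ.Realize b

theorem exists_isolates_of_isEmpty [IsEmpty V] (har : ∀ E, 2 ≤ ar E) {n : ℕ} (a : Fin n → V) :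
    ∃ φ : (hypLang L ar).Formula (Fin n), Isolates α φ a := by
  refine ⟨(⊥ : (hypLang L ar).BoundedFormula (Fin n) 1).all, fun x => isEmptyElim x, ?_⟩
  intro ψ hψ W _ _ _ b hb
  have : IsEmpty W := ⟨hb⟩
  let g : V ≃[hypLang L ar] W :=
    { toEquiv := Equiv.equivOfIsEmpty V W
      map_fun' := fun F _ => F.elim
      map_rel' := by
        rintro k ⟨E, rfl⟩ x
        exact isEmptyElim (x ⟨0, by have := har E; omega⟩) }
  have hb' : b = g ∘ a := funext fun i => isEmptyElim (b i)
  rw [hb']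
  exact (StrongHomClass.realize_formula g ψ).2 hψ

variable [DecidableEq V]

/-- The image of a chart around `a` may be found around any other realization of an isolating
formula. -/
theorem Isolates.exists_isChart (hV : modelsSalpha L ar α V) {n : ℕ}
    {φ : (hypLang L ar).Formula (Fin n)} {a : Fin n → V} (hφ : Isolates α φ a)
    {W : Type} [DecidableEq W] [(hypLang L ar).Structure W] (hW : modelsSalpha L ar α W)
    {b : Fin n → W} (hb : φ.Realize b) {rel : L → Finset ℕ → Prop}
    (hrel : ∀ E e, rel E e → e.card = ar E) {G : Finset ℕ} (hG : G.Nonempty) {p : Fin n → ℕ}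
    (hp : ∀ i, p i ∈ G) :
    (∃ g : ℕ → V, IsChart rel (relOf L ar V) G g ∧ ∀ i, a i = g (p i)) ↔
      ∃ g : ℕ → W, IsChart rel (relOf L ar W) G g ∧ ∀ i, b i = g (p i) := by
  obtain ⟨ψ, hψ⟩ := exists_diagram_formula hrel hG hp
  rw [← hψ hV.1, ← hψ hW.1]
  refine ⟨fun h => hφ.2 ψ h W hW b hb, fun h => ?_⟩
  by_contra hn
  exact hφ.2 ψ.not (Formula.realize_not.2 hn) W hW b hb h

theorem Isolates.exists_delta_lt [Nonempty L] (har : ∀ E, 2 ≤ ar E)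
    (hα : ∀ E, 0 < α E ∧ α E ≤ 1) (hV : modelsSalpha L ar α V) {n : ℕ} (hn : 0 < n)
    {φ : (hypLang L ar).Formula (Fin n)} {a : Fin n → V} (hφ : Isolates α φ a)
    {ξ : ℝ} (hξ : 0 < ξ) :
    ∃ Y : Finset V, (∀ i, a i ∈ Y) ∧ delta α (relOf L ar V) Y < ξ := by
  have : Nonempty V := ⟨a ⟨0, hn⟩⟩
  obtain ⟨t, ht⟩ := exists_realize_iff har hα φ
  obtain ⟨η, hη, hgap⟩ := exists_delta_gap (fun E => (hα E).1) t
  obtain ⟨S, hS⟩ := exists_tStrong_superset_card_le (fun E => (hα E).1) t (univ.image a).card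
  obtain ⟨C, haC, hC, -⟩ := hS hV.nonneg (univ.image a) le_rfl
  obtain ⟨M, f, hf, rfl⟩ := exists_injOn_image_eq C
  have hchart := isChart_pullback (ar := ar) hf
  have hsup := supportedOn_pullback (ar := ar) hf
  have hp : ∀ i, ∃ m ∈ M, f m = a i := fun i =>
    Finset.mem_image.1 (haC (Finset.mem_image_of_mem a (Finset.mem_univ i)))
  choose p hpM hpa using hp
  have hinK := hchart.inK hV
  have h0 : delta α (pullback ar M f) ∅ = 0 := delta_empty har fun E e h => (hsup E e h).2
  obtain ⟨T, hT⟩ := exists_near_extension har hα t M.card (lt_min hη hξ)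
  obtain ⟨rel, G, hMG, hrel, hagree, hGK, hGs, -, hδ, hle⟩ := hT hsup hinK
    ⟨Finset.empty_subset M, fun X _ hX => h0.trans_le (hinK X hX)⟩
    (Finset.card_le_card Finset.sdiff_subset)
  rw [delta_empty har hrel, zero_add] at hδ
  obtain ⟨g, -, hg⟩ := hV.exists_isChart hrel hGK hGs (IsChart.empty har hrel f)
  have hgM : IsChart (pullback ar M f) (relOf L ar V) M g :=
    ⟨(hg.mono hMG).injOn, fun E e he => (hagree E e he).symm.trans ((hg.mono hMG).iff E e he)⟩
  have hempty : ∀ s, tStrong α (relOf L ar V) s ((∅ : Finset ℕ).image g) := fun s =>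
    tStrong.of_delta_eq_zero hV.nonneg
      (by rw [Finset.image_empty]; exact delta_empty har fun E e => relOf_card) s
  have hgt : tStrong α (relOf L ar V) t (M.image g) := by
    refine hg.tStrong_image (fun E => (hα E).1.le) (fun C X => hgap V _ C X)
      (Finset.empty_subset M) hMG (subset_refl M) hle ?_ ?_ (hempty _) le_rfl
    · intro Y hY hMY _
      rw [Finset.Subset.antisymm hY hMY]
    · rw [delta_empty har hrel, zero_add]
      exact hδ.trans_le (min_le_left _ _)
  have hφ' : φ.Realize fun i => g (p i) := by
    refine (ht hV hV hchart hgM hC hgt a default (fun i => g (p i)) default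
      (Sum.elim p Fin.elim0) ?_ ?_ ?_).1 hφ.1
    · rintro (i | i)
      · exact hpM i
      · exact i.elim0
    · rintro (i | i)
      · exact (hpa i).symm
      · exact i.elim0
    · rintro (i | i)
      · rfl
      · exact i.elim0
  obtain ⟨g', hg', hag'⟩ := (hφ.exists_isChart hV hV hφ' hrel ⟨_, hMG (hpM ⟨0, hn⟩)⟩
    fun i => hMG (hpM i)).2 ⟨g, hg, fun _ => rfl⟩
  refine ⟨G.image g', fun i => ?_, ?_⟩
  · rw [hag' i]
    exact Finset.mem_image_of_mem _ (hMG (hpM i))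
  · rw [hg'.delta_image (subset_refl G)]
    exact hδ.trans_le (min_le_right _ _)

theorem Isolates.exists_delta_eq_zero [Nonempty L] (har : ∀ E, 2 ≤ ar E)
    (hα : ∀ E, 0 < α E ∧ α E ≤ 1) (hV : modelsSalpha L ar α V) {n : ℕ} (hn : 0 < n)
    {φ : (hypLang L ar).Formula (Fin n)} {a : Fin n → V} (hφ : Isolates α φ a) :
    ∃ Y : Finset V, (∀ i, a i ∈ Y) ∧ delta α (relOf L ar V) Y = 0 := by
  have : Nonempty V := ⟨a ⟨0, hn⟩⟩
  obtain ⟨t, ht⟩ := exists_realize_iff har hα φ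
  obtain ⟨S, hS⟩ := exists_tStrong_superset_card_le (fun E => (hα E).1) t (univ.image a).card
  obtain ⟨C, haC, hC, -⟩ := hS hV.nonneg (univ.image a) le_rfl
  have haC' : ∀ i, a i ∈ C := fun i => haC (Finset.mem_image_of_mem a (Finset.mem_univ i))
  have hne : (C.powerset.filter fun Y => ∀ i, a i ∈ Y).Nonempty :=
    ⟨C, Finset.mem_filter.2 ⟨Finset.mem_powerset_self C, haC'⟩⟩
  obtain ⟨Y₀, hY₀, hmin⟩ := Finset.exists_min_image _ (delta α (relOf L ar V)) hne
  obtain ⟨-, haY₀⟩ := Finset.mem_filter.1 hY₀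
  refine ⟨Y₀, haY₀, ?_⟩
  by_contra hpos
  obtain ⟨Y, haY, hY⟩ := hφ.exists_delta_lt har hα hV hn
    (lt_of_le_of_ne (hV.nonneg Y₀) (Ne.symm hpos))
  obtain ⟨M, f, hf, rfl⟩ := exists_injOn_image_eq C
  have hchart := isChart_pullback (ar := ar) hf
  have hp : ∀ i, ∃ m ∈ M, f m = a i := fun i => Finset.mem_image.1 (haC' i)
  choose p hpM hpa using hp
  obtain ⟨W, _, _, f', hW, hf', hstrong⟩ := exists_model_strong (fun E => (hα E).1.le)
    (supportedOn_pullback (ar := ar) hf) (hchart.inK hV)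
  have hφ' : φ.Realize fun i => f' (p i) := by
    refine (ht hV hW hchart hf' hC (fun X hX _ => hstrong X hX) a default (fun i => f' (p i))
      default (Sum.elim p Fin.elim0) ?_ ?_ ?_).1 hφ.1
    · rintro (i | i)
      · exact hpM i
      · exact i.elim0
    · rintro (i | i)
      · exact (hpa i).symm
      · exact i.elim0
    · rintro (i | i)
      · rfl
      · exact i.elim0
  obtain ⟨M₁, f₁, hf₁, rfl⟩ := exists_injOn_image_eq Y
  have hchart₁ := isChart_pullback (ar := ar) hf₁
  have hq : ∀ i, ∃ m ∈ M₁, f₁ m = a i := fun i => Finset.mem_image.1 (haY i)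
  choose q hqM hqa using hq
  obtain ⟨g, hg, hbg⟩ := (hφ.exists_isChart hV hW hφ'
    (fun E e h => (supportedOn_pullback (ar := ar) hf₁ E e h).2) ⟨_, hqM ⟨0, hn⟩⟩ hqM).1
    ⟨f₁, hchart₁, fun i => (hqa i).symm⟩
  have h1 : delta α (relOf L ar W) (M₁.image g) = delta α (relOf L ar V) (M₁.image f₁) := by
    rw [hg.delta_image (subset_refl M₁), hchart₁.delta_image (subset_refl M₁)]
  set Z := M.filter fun m => f' m ∈ M₁.image g with hZ
  have hZM : Z ⊆ M := Finset.filter_subset _ _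
  have h2 : M₁.image g ∩ M.image f' = Z.image f' := by
    ext w
    simp only [hZ, Finset.mem_inter, Finset.mem_image (s := M),
      Finset.mem_image (s := Finset.filter _ _), Finset.mem_filter]
    constructor
    · rintro ⟨h, m, hm, rfl⟩
      exact ⟨m, ⟨hm, h⟩, rfl⟩
    · rintro ⟨m, ⟨hm, h⟩, rfl⟩
      exact ⟨h, m, hm, rfl⟩
  have h3 := delta_submodular (fun E => (hα E).1.le) (relOf L ar W) (M₁.image g) (M.image f')
  have h4 := hstrong _ (Finset.subset_union_right (s₁ := M₁.image g))
  rw [h2, hf'.delta_image hZM, ← hchart.delta_image hZM] at h3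
  have h5 := hmin (Z.image f) (Finset.mem_filter.2
    ⟨Finset.mem_powerset.2 (Finset.image_subset_image hZM), fun i => ?_⟩)
  · linarith
  · rw [← hpa i]
    refine Finset.mem_image_of_mem _ (Finset.mem_filter.2 ⟨hpM i, ?_⟩)
    rw [show f' (p i) = g (q i) from hbg i]
    exact Finset.mem_image_of_mem _ (hqM i)

theorem exists_isolates_of_delta_eq_zero [Nonempty L] [Nonempty V] (har : ∀ E, 2 ≤ ar E)
    (hα : ∀ E, 0 < α E ∧ α E ≤ 1) (hV : modelsSalpha L ar α V)
    (h : ∀ A : Finset V, ∃ B : Finset V, A ⊆ B ∧ delta α (relOf L ar V) B = 0) {n : ℕ}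
    (a : Fin n → V) : ∃ φ : (hypLang L ar).Formula (Fin n), Isolates α φ a := by
  obtain ⟨B, hB, hB0⟩ := h (insert (Classical.arbitrary V) (univ.image a))
  obtain ⟨M, f, hf, rfl⟩ := exists_injOn_image_eq B
  have hchart := isChart_pullback (ar := ar) hf
  have hp : ∀ i, ∃ m ∈ M, f m = a i := fun i => Finset.mem_image.1
    (hB (Finset.mem_insert_of_mem (Finset.mem_image_of_mem a (Finset.mem_univ i))))
  choose p hpM hpa using hp
  have hM : M.Nonempty := Finset.image_nonempty.1 ⟨_, hB (Finset.mem_insert_self _ _)⟩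
  obtain ⟨φ, hφ⟩ := exists_diagram_formula
    (fun E e h => (supportedOn_pullback (ar := ar) hf E e h).2) hM hpM
  refine ⟨φ, (hφ hV.1 a).2 ⟨f, hchart, fun i => (hpa i).symm⟩, ?_⟩
  intro ψ hψ W _ _ hW b hb
  obtain ⟨g, hg, hbg⟩ := (hφ hW.1 b).1 hb
  obtain ⟨t, ht⟩ := exists_realize_iff har hα ψ
  have hg0 : delta α (relOf L ar W) (M.image g) = 0 := by
    rw [hg.delta_image (subset_refl M), ← hchart.delta_image (subset_refl M), hB0]
  refine (ht hV hW hchart hg (tStrong.of_delta_eq_zero hV.nonneg hB0 t)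
    (tStrong.of_delta_eq_zero hW.nonneg hg0 t) a default b default
    (Sum.elim p Fin.elim0) ?_ ?_ ?_).1 hψ
  · rintro (i | i)
    · exact hpM i
    · exact i.elim0
  · rintro (i | i)
    · exact (hpa i).symm
    · exact i.elim0
  · rintro (i | i)
    · exact hbg i
    · exact i.elim0

end Atomic

/-- A model `M` of `S_α` is atomic iff every finite substructure `A ⊆ M` is
contained in a finite substructure `B ⊆ M` with `δ(B) = 0`. -/
theorem stmt18 {L : Type} [Fintype L] [Nonempty L] (ar : L → ℕ)
    (har : ∀ E, 2 ≤ ar E) (α : L → ℝ) (hα : ∀ E, 0 < α E ∧ α E ≤ 1)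
    (V : Type) [DecidableEq V] [(hypLang L ar).Structure V]
    (hmod : modelsSalpha L ar α V) :
    atomicModel L ar α V ↔
      ∀ A : Finset V, ∃ B : Finset V, A ⊆ B ∧ delta α (relOf L ar V) B = 0 := by
  constructor
  · intro hat A
    rcases A.eq_empty_or_nonempty with rfl | hA
    · exact ⟨∅, subset_refl _, delta_empty har fun E e => relOf_card⟩
    · obtain ⟨φ, hφ⟩ := hat A.card fun i => A.equivFin.symm i
      obtain ⟨Y, hAY, hY⟩ := Isolates.exists_delta_eq_zero har hα hmod hA.card_pos hφ
      refine ⟨Y, fun x hx => ?_, hY⟩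
      simpa using hAY (A.equivFin ⟨x, hx⟩)
  · intro h n a
    rcases isEmpty_or_nonempty V with hV | hV
    · exact exists_isolates_of_isEmpty har a
    · exact exists_isolates_of_delta_eq_zero har hα hmod h a
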